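/- arXiv:2308.15782 — 5 statements merged into one kernel-verified Lean document; each statement's English description precedes it below -/
import Mathlib

section
/- Let z, u be positive reals with z·(u + 1/u) < 1 and let q ∈ (0,1]. Then the double series Σ_{m1≥0} Σ_{m2≥0} g_{m1,m2}(q)·z^{m1+m2}·u^{m2−m1} converges absolutely and equals ((2q·u²·z + (q−1)²·u − q·(q−1)·z)·P(z²) − z·u·(u + q·(q−1)·z)) / (z·u·(z·u² − u + z)·(1 − 2q·P(z²))). -/
/-- The polynomials `g_{m1,m2}(q)` defined by the recurrence
`g_{m1,m2}(q) = q^{δ(c,m1)} g_{m1-1,m2}(q) + g_{m1,m2-1}(q)` with `c = ⌊(m1+m2)/2⌋+1`,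
`g_{0,0} = 1` and `g` vanishing for negative indices. -/
noncomputable def gP : ℕ → ℕ → Polynomial ℝ
  | 0, 0 => 1
  | 0, m2 + 1 => gP 0 m2
  | m1 + 1, 0 =>
      Polynomial.X ^ (if (m1 + 1) / 2 + 1 = m1 + 1 then 1 else 0) * gP m1 0
  | m1 + 1, m2 + 1 =>
      Polynomial.X ^ (if (m1 + 1 + (m2 + 1)) / 2 + 1 = m1 + 1 then 1 else 0) * gP m1 (m2 + 1)
        + gP (m1 + 1) m2

/-- `P(t) = (1 - √(1-4t))/2`, the generating function of shifted Catalan numbers. -/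
noncomputable def Pgf (t : ℝ) : ℝ := (1 - Real.sqrt (1 - 4 * t)) / 2

section

open Finset Filter Topology

/-- The factor picked up when passing from `(i, j)` to `(i + 1, j)` in the recurrence. -/
def stepWeight (q : ℝ) (i j : ℕ) : ℝ := if (i + 1 + j) / 2 + 1 = i + 1 then q else 1

lemma stepWeight_nonneg {q : ℝ} (hq : 0 ≤ q) (i j : ℕ) : 0 ≤ stepWeight q i j := by
  unfold stepWeight; split_ifs <;> linarith

lemma stepWeight_le_one {q : ℝ} (hq : q ≤ 1) (i j : ℕ) : stepWeight q i j ≤ 1 := by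
  unfold stepWeight; split_ifs <;> linarith

lemma eval_gP_zero_succ (q : ℝ) (j : ℕ) : (gP 0 (j + 1)).eval q = (gP 0 j).eval q := by
  rw [gP]

lemma eval_gP_succ_zero (q : ℝ) (i : ℕ) :
    (gP (i + 1) 0).eval q = stepWeight q i 0 * (gP i 0).eval q := by
  rw [gP, stepWeight]; split_ifs <;> simp_all

lemma eval_gP_succ_succ (q : ℝ) (i j : ℕ) :
    (gP (i + 1) (j + 1)).eval q
      = stepWeight q i (j + 1) * (gP i (j + 1)).eval q + (gP (i + 1) j).eval q := by
  rw [gP, stepWeight]; split_ifs <;> simp_all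

lemma eval_gP_nonneg {q : ℝ} (hq : 0 ≤ q) (i j : ℕ) : 0 ≤ (gP i j).eval q := by
  induction i generalizing j with
  | zero =>
    induction j with
    | zero => simp [gP]
    | succ j ih => rwa [eval_gP_zero_succ]
  | succ i ihi =>
    induction j with
    | zero => rw [eval_gP_succ_zero]; exact mul_nonneg (stepWeight_nonneg hq _ _) (ihi 0)
    | succ j ih =>
      rw [eval_gP_succ_succ]
      exact add_nonneg (mul_nonneg (stepWeight_nonneg hq _ _) (ihi _)) ih

/-- The recurrence for `gP`, summed against a test function over an antidiagonal. -/
lemma sum_antidiagonal_gP_succ (q : ℝ) (f : ℕ → ℕ → ℝ) (n : ℕ) :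
    ∑ p ∈ antidiagonal (n + 1), (gP p.1 p.2).eval q * f p.1 p.2
      = ∑ p ∈ antidiagonal n, (gP p.1 p.2).eval q *
          (stepWeight q p.1 p.2 * f (p.1 + 1) p.2 + f p.1 (p.2 + 1)) := by
  let A : ℕ → ℕ → ℝ := fun i j => match i with
    | 0 => 0
    | i + 1 => stepWeight q i j * (gP i j).eval q
  let B : ℕ → ℕ → ℝ := fun i j => match j with
    | 0 => 0
    | j + 1 => (gP i j).eval q
  have hAB : ∀ p ∈ antidiagonal (n + 1), (gP p.1 p.2).eval q * f p.1 p.2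
      = A p.1 p.2 * f p.1 p.2 + B p.1 p.2 * f p.1 p.2 := by
    rintro ⟨i, j⟩ hp
    rw [HasAntidiagonal.mem_antidiagonal] at hp
    rcases i with _ | i <;> rcases j with _ | j
    · simp at hp
    · simp [A, B, eval_gP_zero_succ]
    · simp [A, B, eval_gP_succ_zero]
    · simp only [A, B, eval_gP_succ_succ]; ring
  rw [sum_congr rfl hAB, sum_add_distrib, Nat.sum_antidiagonal_succ (f := fun p => A p.1 p.2 * _),
    Nat.sum_antidiagonal_succ' (f := fun p => B p.1 p.2 * _)]
  simp only [A, B, zero_mul, zero_add]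
  rw [← sum_add_distrib]
  exact sum_congr rfl fun p _ => by ring

lemma hasSum_prod_of_antidiagonal {F : ℕ × ℕ → ℝ} {s : ℝ} (hF : ∀ p, 0 ≤ F p)
    (h : HasSum (fun n => ∑ p ∈ antidiagonal n, F p) s) : HasSum F s := by
  rw [← Finset.HasAntidiagonal.sigmaAntidiagonalEquivProd.hasSum_iff]
  have hfib : ∀ n : ℕ, HasSum (fun p : antidiagonal n => F p) (∑ p ∈ antidiagonal n, F p) :=
    fun n => (antidiagonal n).hasSum F
  have hsum : Summable (F ∘ Finset.HasAntidiagonal.sigmaAntidiagonalEquivProd) := by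
    refine (summable_sigma_of_nonneg fun _ => hF _).2 ⟨fun n => (hfib n).summable, ?_⟩
    exact h.summable.congr fun n => (hfib n).tsum_eq.symm
  exact (hsum.hasSum.sigma hfib).unique h ▸ hsum.hasSum

/-- A solution `ψ` of the adjoint recurrence with source `a ^ i * b ^ j` that is dominated by this
source computes the generating function of `gP`. -/
lemma hasSum_gP_of_adjoint {q a b C : ℝ} (hq₀ : 0 ≤ q) (hq₁ : q ≤ 1) (ha : 0 ≤ a) (hb : 0 ≤ b)
    (hab : a + b < 1) {ψ : ℕ → ℕ → ℝ}
    (hψ : ∀ i j, ψ i j = a ^ i * b ^ j + (stepWeight q i j * ψ (i + 1) j + ψ i (j + 1)))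
    (hC : ∀ i j, |ψ i j| ≤ C * (a ^ i * b ^ j)) :
    HasSum (fun p : ℕ × ℕ => (gP p.1 p.2).eval q * (a ^ p.1 * b ^ p.2)) (ψ 0 0) := by
  have hF : ∀ p : ℕ × ℕ, 0 ≤ (gP p.1 p.2).eval q * (a ^ p.1 * b ^ p.2) := fun p =>
    mul_nonneg (eval_gP_nonneg hq₀ _ _) (by positivity)
  refine hasSum_prod_of_antidiagonal hF ?_
  set S : ℕ → ℝ := fun n => ∑ p ∈ antidiagonal n, (gP p.1 p.2).eval q * (a ^ p.1 * b ^ p.2)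
    with hS
  set R : ℕ → ℝ := fun n => ∑ p ∈ antidiagonal n, (gP p.1 p.2).eval q * ψ p.1 p.2 with hR
  have hS_nonneg : ∀ n, 0 ≤ S n := fun n => sum_nonneg fun p _ => hF p
  have hS_le : ∀ n, S n ≤ (a + b) ^ n := by
    intro n
    induction n with
    | zero => simp [hS, gP]
    | succ n ih =>
      have : S (n + 1) ≤ S n * (a + b) := by
        simp only [hS]
        rw [sum_antidiagonal_gP_succ q (fun i j => a ^ i * b ^ j), sum_mul]
        refine sum_le_sum fun p _ => ?_
        rw [mul_assoc]
        refine mul_le_mul_of_nonneg_left ?_ (eval_gP_nonneg hq₀ _ _)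
        have := mul_le_mul_of_nonneg_right (stepWeight_le_one hq₁ p.1 p.2)
          (show 0 ≤ a ^ (p.1 + 1) * b ^ p.2 by positivity)
        calc _ ≤ 1 * (a ^ (p.1 + 1) * b ^ p.2) + a ^ p.1 * b ^ (p.2 + 1) := by gcongr
          _ = _ := by ring
      calc S (n + 1) ≤ S n * (a + b) := this
        _ ≤ (a + b) ^ n * (a + b) := by gcongr
        _ = _ := (pow_succ _ _).symm
  have hS_tendsto : Tendsto S atTop (𝓝 0) :=
    squeeze_zero hS_nonneg hS_le (tendsto_pow_atTop_nhds_zero_of_lt_one (by positivity) hab)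
  have hR_succ : ∀ n, R n = S n + R (n + 1) := by
    intro n
    simp only [hR, hS]
    rw [sum_antidiagonal_gP_succ, ← sum_add_distrib]
    refine sum_congr rfl fun p _ => ?_
    rw [hψ p.1 p.2]; ring
  have hR_le : ∀ n, |R n| ≤ C * S n := by
    intro n
    simp only [hR, hS]
    rw [mul_sum]
    refine (abs_sum_le_sum_abs _ _).trans (sum_le_sum fun p _ => ?_)
    rw [abs_mul, abs_of_nonneg (eval_gP_nonneg hq₀ _ _)]
    have := mul_le_mul_of_nonneg_left (hC p.1 p.2) (eval_gP_nonneg hq₀ p.1 p.2)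
    linarith
  have hR_tendsto : Tendsto R atTop (𝓝 0) :=
    squeeze_zero_norm hR_le (by simpa using hS_tendsto.const_mul C)
  have hpartial : ∀ n, ∑ k ∈ range n, S k = ψ 0 0 - R n := by
    intro n
    induction n with
    | zero => simp [hR, gP]
    | succ n ih => rw [sum_range_succ, ih, hR_succ n]; ring
  rw [hasSum_iff_tendsto_nat_of_nonneg hS_nonneg]
  simp only [hpartial]
  simpa using hR_tendsto.const_sub (ψ 0 0)

/-- The homogeneous part of the adjoint solution: geometric on either side of the diagonal. -/
noncomputable def diagonalDecay (α β t P : ℝ) (i j : ℕ) : ℝ :=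
  if i ≤ j then α * t ^ i * P ^ (j - i) else β * t ^ j * P ^ (i - j - 1)

lemma diagonalDecay_above (α β t P : ℝ) (i k : ℕ) :
    diagonalDecay α β t P i (i + k) = α * t ^ i * P ^ k := by
  simp [diagonalDecay]

lemma diagonalDecay_below (α β t P : ℝ) (j k : ℕ) :
    diagonalDecay α β t P (j + k + 1) j = β * t ^ j * P ^ k := by
  rw [diagonalDecay, if_neg (by omega)]
  congr 2; omega

lemma abs_diagonalDecay_le {α β a b P : ℝ} (ha : 0 < a) (hb : 0 ≤ b) (hP₀ : 0 ≤ P)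
    (hPa : P ≤ a) (hPb : P ≤ b) (i j : ℕ) :
    |diagonalDecay α β (a * b) P i j| ≤ (|α| + |β| / a) * (a ^ i * b ^ j) := by
  rcases le_or_gt i j with h | h
  · obtain ⟨k, rfl⟩ := Nat.exists_eq_add_of_le h
    rw [diagonalDecay_above, abs_mul, abs_mul, abs_of_nonneg (a := (a * b) ^ i) (by positivity),
      abs_of_nonneg (a := P ^ k) (by positivity)]
    calc |α| * (a * b) ^ i * P ^ k ≤ |α| * (a * b) ^ i * b ^ k := by gcongr
      _ = |α| * (a ^ i * b ^ (i + k)) := by ring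
      _ ≤ _ := by gcongr; exact le_add_of_nonneg_right (by positivity)
  · obtain ⟨k, rfl⟩ := Nat.exists_eq_add_of_lt h
    rw [diagonalDecay_below, abs_mul, abs_mul, abs_of_nonneg (a := (a * b) ^ j) (by positivity),
      abs_of_nonneg (a := P ^ k) (by positivity)]
    calc |β| * (a * b) ^ j * P ^ k ≤ |β| * (a * b) ^ j * a ^ k := by gcongr
      _ = |β| / a * (a ^ (j + k + 1) * b ^ j) := by field_simp; ring
      _ ≤ _ := by gcongr; exact le_add_of_nonneg_left (by positivity)

lemma adjoint_solution {q a b K α β P : ℝ} (hP : P = a * b + P ^ 2) (hK : K = 1 + (a + b) * K)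
    (hα : α = (q - 1) * K * a + q * β + α * P)
    (hβ : β = (q - 1) * K * a ^ 2 + q * β * P + α * (a * b)) {ψ : ℕ → ℕ → ℝ}
    (hψ : ψ = fun i j => K * (a ^ i * b ^ j) + diagonalDecay α β (a * b) P i j) (i j : ℕ) :
    ψ i j = a ^ i * b ^ j + (stepWeight q i j * ψ (i + 1) j + ψ i (j + 1)) := by
  subst hψ
  rcases lt_trichotomy i j with h | rfl | h
  · obtain ⟨k, rfl⟩ := Nat.exists_eq_add_of_lt h
    have h₁ := diagonalDecay_above α β (a * b) P i (k + 1)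
    have h₂ := diagonalDecay_above α β (a * b) P (i + 1) k
    have h₃ := diagonalDecay_above α β (a * b) P i (k + 2)
    rw [show i + 1 + k = i + k + 1 by ring] at h₂
    simp only [← add_assoc] at h₁ h₃
    simp only [h₁, h₂, h₃]
    rw [stepWeight, if_neg (by omega)]
    linear_combination (a ^ i * b ^ (i + k + 1)) * hK + α * (a * b) ^ i * P ^ k * hP
  · have h₁ := diagonalDecay_above α β (a * b) P i 0
    have h₂ := diagonalDecay_below α β (a * b) P i 0
    have h₃ := diagonalDecay_above α β (a * b) P i 1
    simp only [add_zero] at h₁ h₂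
    simp only [h₁, h₂, h₃]
    rw [stepWeight, if_pos (by omega)]
    linear_combination (a ^ i * b ^ i) * hK + (a * b) ^ i * hα
  · obtain ⟨k, rfl⟩ := Nat.exists_eq_add_of_lt h
    rcases k with _ | k
    · have h₁ := diagonalDecay_below α β (a * b) P j 0
      have h₂ := diagonalDecay_below α β (a * b) P j 1
      have h₃ := diagonalDecay_above α β (a * b) P (j + 1) 0
      simp only [add_zero] at h₁ h₃
      simp only [add_zero, h₁, h₂, h₃]
      rw [stepWeight, if_pos (by omega)]
      linear_combination (a ^ (j + 1) * b ^ j) * hK + (a * b) ^ j * hβ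
    · have h₁ := diagonalDecay_below α β (a * b) P j (k + 1)
      have h₂ := diagonalDecay_below α β (a * b) P j (k + 2)
      have h₃ := diagonalDecay_below α β (a * b) P (j + 1) k
      rw [show j + 1 + k + 1 = j + (k + 1) + 1 by ring] at h₃
      rw [show j + (k + 2) + 1 = j + (k + 1) + 1 + 1 by ring] at h₂
      simp only [h₁, h₂, h₃]
      rw [stepWeight, if_neg (by omega)]
      linear_combination (a ^ (j + (k + 1) + 1) * b ^ j) * hK + β * (a * b) ^ j * P ^ k * hP

lemma hasSum_gP {q a b P : ℝ} (hq₀ : 0 ≤ q) (hq₁ : q ≤ 1) (ha : 0 < a) (hb : 0 < b)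
    (hab : a + b < 1) (hP₀ : 0 ≤ P) (hP₁ : P < 1 / 2) (hP : P * (1 - P) = a * b) :
    HasSum (fun p : ℕ × ℕ => (gP p.1 p.2).eval q * (a ^ p.1 * b ^ p.2))
      (1 / (1 - a - b) * (1 + ((q - 1) * a + q * ((q - 1) * a * (a + P) / (1 - 2 * q * P)))
        / (1 - P))) := by
  have hPa : P ≤ a := by by_contra! h; nlinarith
  have hPb : P ≤ b := by by_contra! h; nlinarith
  have hK₀ : 1 - a - b ≠ 0 := by linarith
  have hP₂ : 1 - P ≠ 0 := by linarith
  have hqP : 1 - 2 * q * P ≠ 0 := by nlinarith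
  set K : ℝ := 1 / (1 - a - b) with hKdef
  set β : ℝ := (q - 1) * K * a * (a + P) / (1 - 2 * q * P) with hβdef
  set α : ℝ := ((q - 1) * K * a + q * β) / (1 - P) with hαdef
  have hK : K = 1 + (a + b) * K := by rw [hKdef]; field_simp; ring
  have hα' : α * (1 - P) = (q - 1) * K * a + q * β := by rw [hαdef, div_mul_cancel₀ _ hP₂]
  have hβ' : β * (1 - 2 * q * P) = (q - 1) * K * a * (a + P) := by rw [hβdef, div_mul_cancel₀ _ hqP]
  set ψ : ℕ → ℕ → ℝ := fun i j => K * (a ^ i * b ^ j) + diagonalDecay α β (a * b) P i j with hψ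
  have hrec := adjoint_solution (q := q) (by linear_combination hP) hK
    (by linear_combination hα') (by linear_combination hβ' + α * hP - P * hα') hψ
  have hbound : ∀ i j, |ψ i j| ≤ (|K| + (|α| + |β| / a)) * (a ^ i * b ^ j) := by
    intro i j
    have h := abs_diagonalDecay_le (α := α) (β := β) ha hb.le hP₀ hPa hPb i j
    calc |ψ i j| ≤ |K * (a ^ i * b ^ j)| + |diagonalDecay α β (a * b) P i j| := abs_add_le _ _
      _ ≤ |K| * (a ^ i * b ^ j) + (|α| + |β| / a) * (a ^ i * b ^ j) := by
        rw [abs_mul, abs_of_nonneg (a := a ^ i * b ^ j) (by positivity)]; gcongr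
      _ = _ := by ring
  convert hasSum_gP_of_adjoint hq₀ hq₁ ha.le hb.le hab hrec hbound using 1
  have h₀ : ψ 0 0 = K + α := by simp [hψ, diagonalDecay]
  rw [h₀, hαdef, hβdef]
  field_simp

lemma Pgf_mul_one_sub {t : ℝ} (ht : t ≤ 1 / 4) : Pgf t * (1 - Pgf t) = t := by
  have := Real.sq_sqrt (show 0 ≤ 1 - 4 * t by linarith)
  unfold Pgf
  linear_combination -this / 4

lemma Pgf_nonneg {t : ℝ} (ht : 0 ≤ t) : 0 ≤ Pgf t := by
  have : Real.sqrt (1 - 4 * t) ≤ 1 := Real.sqrt_le_one.2 (by linarith)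
  unfold Pgf; linarith

lemma Pgf_lt_half {t : ℝ} (ht : t < 1 / 4) : Pgf t < 1 / 2 := by
  have : 0 < Real.sqrt (1 - 4 * t) := Real.sqrt_pos.2 (by linarith)
  unfold Pgf; linarith

end

theorem stmt0 (z u q : ℝ) (hz : 0 < z) (hu : 0 < u) (hzu : z * (u + 1 / u) < 1)
    (hq : q ∈ Set.Ioc (0 : ℝ) 1) :
    Summable (fun p : ℕ × ℕ =>
      (gP p.1 p.2).eval q * z ^ (p.1 + p.2) * u ^ ((p.2 : ℤ) - (p.1 : ℤ))) ∧
    ∑' p : ℕ × ℕ, (gP p.1 p.2).eval q * z ^ (p.1 + p.2) * u ^ ((p.2 : ℤ) - (p.1 : ℤ))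
      = ((2 * q * u ^ 2 * z + (q - 1) ^ 2 * u - q * (q - 1) * z) * Pgf (z ^ 2)
          - z * u * (u + q * (q - 1) * z))
        / (z * u * (z * u ^ 2 - u + z) * (1 - 2 * q * Pgf (z ^ 2))) := by
  obtain ⟨hq₀, hq₁⟩ := hq
  have hab : z / u + z * u < 1 := by
    calc z / u + z * u = z * (u + 1 / u) := by field_simp; ring
      _ < 1 := hzu
  have ht : z ^ 2 < 1 / 4 := by
    have h : z / u * (z * u) = z ^ 2 := by field_simp
    have : 0 < z / u := by positivity
    have : 0 < z * u := by positivity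
    nlinarith [sq_nonneg (z / u - z * u)]
  set P := Pgf (z ^ 2)
  have hPz : P * (1 - P) = z ^ 2 := Pgf_mul_one_sub ht.le
  have hP₀ : 0 ≤ P := Pgf_nonneg (by positivity)
  have hP₁ : P < 1 / 2 := Pgf_lt_half ht
  have hsum := hasSum_gP hq₀.le hq₁ (div_pos hz hu) (mul_pos hz hu) hab hP₀ hP₁
    (by rw [hPz]; field_simp)
  have hterm : (fun p : ℕ × ℕ =>
      (gP p.1 p.2).eval q * z ^ (p.1 + p.2) * u ^ ((p.2 : ℤ) - (p.1 : ℤ)))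
      = fun p : ℕ × ℕ => (gP p.1 p.2).eval q * ((z / u) ^ p.1 * (z * u) ^ p.2) := by
    funext p
    rw [zpow_sub₀ hu.ne', zpow_natCast, zpow_natCast, div_pow, mul_pow, pow_add]
    ring
  rw [hterm]
  refine ⟨hsum.summable, hsum.tsum_eq.trans ?_⟩
  have hD : z * u ^ 2 - u + z ≠ 0 := by
    have : z * u ^ 2 - u + z = u * (z / u + z * u - 1) := by field_simp; ring
    rw [this]
    exact mul_ne_zero hu.ne' (by linarith)
  have hK : 1 - z / u - z * u = -(z * u ^ 2 - u + z) / u := by field_simp; ring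
  have hP₂ : 1 - P ≠ 0 := by linarith
  have hqP : 1 - 2 * q * P ≠ 0 := by nlinarith
  have hinv : ∀ x : ℝ, x / (1 - P) = x * P / z ^ 2 := by
    intro x
    rw [div_eq_div_iff hP₂ (by positivity), ← hPz]; ring
  rw [hK, hinv]
  set D := z * u ^ 2 - u + z
  clear_value D
  set E := 1 - 2 * q * P with hEdef
  clear_value E
  field_simp
  rw [hEdef]
  linear_combination (-q * (q - 1) * u) * hPz
end

section
/- Let z ∈ (0,1/2) and q ∈ (0,1]. Then Σ_{m≥0} g_{m,m}(q)·z^{2m} = ((1−q)·P(z²) + q·z²) / (z²·(1 − 2q·P(z²))). -/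
/-- The term `g_{i,j}(q) z^{i+j}` of the generating function of weighted lattice paths. -/
noncomputable def pathTerm (q z : ℝ) (i j : ℕ) : ℝ := (gP i j).eval q * z ^ (i + j)

lemma eval_gP_mem_Icc {q : ℝ} (hq0 : 0 ≤ q) (hq1 : q ≤ 1) (i j : ℕ) :
    (gP i j).eval q ∈ Set.Icc (0 : ℝ) (2 ^ (i + j)) := by
  have hw (p : Prop) [Decidable p] :
      0 ≤ q ^ (if p then 1 else 0) ∧ q ^ (if p then 1 else 0) ≤ 1 :=
    ⟨pow_nonneg hq0 _, pow_le_one₀ hq0 hq1⟩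
  induction i, j using gP.induct with
  | case1 => simp [gP]
  | case2 j ih =>
    rw [gP]
    refine ⟨ih.1, ih.2.trans ?_⟩
    gcongr <;> norm_num
  | case3 i ih =>
    rw [gP, Polynomial.eval_mul, Polynomial.eval_pow, Polynomial.eval_X]
    obtain ⟨h0, h1⟩ := hw ((i + 1) / 2 + 1 = i + 1)
    refine ⟨mul_nonneg h0 ih.1, (mul_le_of_le_one_left ih.1 h1).trans (ih.2.trans ?_)⟩
    gcongr <;> norm_num
  | case4 i j ih1 ih2 =>
    rw [gP, Polynomial.eval_add, Polynomial.eval_mul, Polynomial.eval_pow, Polynomial.eval_X]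
    obtain ⟨h0, h1⟩ := hw ((i + 1 + (j + 1)) / 2 + 1 = i + 1)
    refine ⟨add_nonneg (mul_nonneg h0 ih1.1) ih2.1,
      (add_le_add ((mul_le_of_le_one_left ih1.1 h1).trans ih1.2) ih2.2).trans_eq ?_⟩
    rw [Nat.succ_eq_add_one, Nat.succ_eq_add_one]
    ring

lemma pathTerm_mem_Icc {q z : ℝ} (hq0 : 0 ≤ q) (hq1 : q ≤ 1) (hz : z ∈ Set.Ioo (0 : ℝ) (1 / 2))
    {i j m : ℕ} (h : 2 * m ≤ i + j) :
    pathTerm q z i j ∈ Set.Icc 0 (((2 * z) ^ 2) ^ m) := by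
  obtain ⟨hz0, hz1⟩ := hz
  obtain ⟨h0, h1⟩ := eval_gP_mem_Icc hq0 hq1 i j
  refine ⟨mul_nonneg h0 (by positivity), ?_⟩
  calc pathTerm q z i j ≤ 2 ^ (i + j) * z ^ (i + j) := by unfold pathTerm; gcongr
    _ = (2 * z) ^ (i + j) := (mul_pow _ _ _).symm
    _ ≤ (2 * z) ^ (2 * m) := pow_le_pow_of_le_one (by linarith) (by linarith) h
    _ = _ := pow_mul _ _ _

lemma summable_two_mul_sq_pow {z : ℝ} (hz : z ∈ Set.Ioo (0 : ℝ) (1 / 2)) :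
    Summable fun m : ℕ => ((2 * z) ^ 2) ^ m := by
  obtain ⟨hz0, hz1⟩ := hz
  exact summable_geometric_of_lt_one (by positivity) (by nlinarith)

lemma tsum_eq_of_shift {f g h : ℕ → ℝ} {c d : ℝ} (hf : Summable f) (hg : Summable g)
    (hh : Summable h) (h0 : f 0 = c * g 0) (hs : ∀ m, f (m + 1) = c * g (m + 1) + d * h m) :
    ∑' m, f m = c * ∑' m, g m + d * ∑' m, h m := by
  rw [hf.tsum_eq_zero_add, hg.tsum_eq_zero_add, h0]
  simp_rw [hs]
  rw [(((summable_nat_add_iff 1).2 hg).mul_left c).tsum_add (hh.mul_left d), tsum_mul_left,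
    tsum_mul_left]
  ring

lemma pathTerm_zero_zero (q z : ℝ) : pathTerm q z 0 0 = 1 := by simp [pathTerm, gP]

lemma pathTerm_right (q z : ℝ) (k : ℕ) :
    pathTerm q z (k + 1) 0 = (if k < 2 then q else 1) * z * pathTerm q z k 0 := by
  have h : (if (k + 1) / 2 + 1 = k + 1 then 1 else 0) = if k < 2 then 1 else 0 := by
    congr 1; simp only [eq_iff_iff]; omega
  simp only [pathTerm, gP, h]
  split_ifs <;> simp <;> ring

lemma pathTerm_right_succ (q z : ℝ) (k m : ℕ) :
    pathTerm q z (m + 1 + (k + 1)) (m + 1) =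
      (if k < 2 then q else 1) * z * pathTerm q z (m + 1 + k) (m + 1)
        + z * pathTerm q z (m + (k + 2)) m := by
  have h : (if (m + 1 + k + 1 + (m + 1)) / 2 + 1 = m + 1 + k + 1 then 1 else 0)
      = if k < 2 then 1 else 0 := by
    congr 1; simp only [eq_iff_iff]; omega
  rw [show m + 1 + (k + 1) = m + 1 + k + 1 by ring, show m + (k + 2) = m + 1 + k + 1 by ring]
  simp only [pathTerm, gP, h]
  split_ifs <;> simp <;> ring

lemma pathTerm_left (q z : ℝ) (k : ℕ) : pathTerm q z 0 (k + 1) = z * pathTerm q z 0 k := by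
  simp only [pathTerm, gP]
  ring

lemma pathTerm_left_succ (q z : ℝ) (k m : ℕ) :
    pathTerm q z (m + 1) (m + 1 + (k + 1)) =
      z * pathTerm q z (m + 1) (m + 1 + k) + z * pathTerm q z m (m + (k + 2)) := by
  have h : ¬ ((m + 1 + (m + 1 + k + 1)) / 2 + 1 = m + 1) := by omega
  rw [show m + 1 + (k + 1) = m + 1 + k + 1 by ring, show m + (k + 2) = m + 1 + k + 1 by ring]
  simp only [pathTerm, gP, h, if_false]
  simp
  ring

lemma pathTerm_diag_succ (q z : ℝ) (m : ℕ) :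
    pathTerm q z (m + 1) (m + 1) = z * pathTerm q z m (m + 1) + z * pathTerm q z (m + 1) m := by
  have h : ¬ ((m + 1 + (m + 1)) / 2 + 1 = m + 1) := by omega
  simp only [pathTerm, gP, h, if_false]
  simp
  ring

/-- A bounded solution of `a (k + 1) = z * (a k + a (k + 2))` is geometric, its ratio being the
root of `z * x ^ 2 - x + z` of modulus less than one. -/
lemma mul_eq_of_bounded_recurrence {z P : ℝ} (hz : 0 < z) (hzP : z < 1 - P)
    (hP : P * (1 - P) = z ^ 2) {a : ℕ → ℝ} {M : ℝ} (hM : ∀ k, |a k| ≤ M)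
    (ha : ∀ k, a (k + 1) = z * a k + z * a (k + 2)) : z * a 1 = P * a 0 := by
  have hb (k : ℕ) : z * a (k + 1) - P * a k = ((1 - P) / z) ^ k * (z * a 1 - P * a 0) := by
    induction k with
    | zero => simp
    | succ k ih =>
      rw [pow_succ', mul_assoc, ← ih]
      field_simp
      linear_combination (-z) * ha k + a k * hP
  by_contra hne
  have hpos : 0 < |z * a 1 - P * a 0| := abs_pos.2 (sub_ne_zero.2 hne)
  obtain ⟨n, hn⟩ := pow_unbounded_of_one_lt ((z * M + |P| * M) / |z * a 1 - P * a 0|)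
    ((one_lt_div hz).2 hzP)
  rw [div_lt_iff₀ hpos] at hn
  have hbound : |z * a (n + 1) - P * a n| ≤ z * M + |P| * M := by
    refine (abs_sub _ _).trans ?_
    rw [abs_mul, abs_mul, abs_of_pos hz]
    gcongr <;> exact hM _
  have hr : 0 ≤ (1 - P) / z := div_nonneg (hz.trans hzP).le hz.le
  rw [hb, abs_mul, abs_of_nonneg (pow_nonneg hr n)] at hbound
  linarith

theorem stmt2 (z q : ℝ) (hz : z ∈ Set.Ioo (0 : ℝ) (1 / 2)) (hq : q ∈ Set.Ioc (0 : ℝ) 1) :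
    Summable (fun m : ℕ => (gP m m).eval q * z ^ (2 * m)) ∧
    ∑' m : ℕ, (gP m m).eval q * z ^ (2 * m)
      = ((1 - q) * Pgf (z ^ 2) + q * z ^ 2) / (z ^ 2 * (1 - 2 * q * Pgf (z ^ 2))) := by
  have hdiag : (fun m : ℕ => (gP m m).eval q * z ^ (2 * m)) = fun m => pathTerm q z m m := by
    funext m; rw [pathTerm, two_mul]
  have hterm {i j m : ℕ} := pathTerm_mem_Icc (i := i) (j := j) (m := m) hq.1.le hq.2 hz
  have hgeo := summable_two_mul_sq_pow hz
  have hsA (k : ℕ) : Summable fun m => pathTerm q z (m + k) m :=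
    hgeo.of_nonneg_of_le (fun m => (hterm (m := m) (by omega)).1) fun m => (hterm (by omega)).2
  have hsB (k : ℕ) : Summable fun m => pathTerm q z m (m + k) :=
    hgeo.of_nonneg_of_le (fun m => (hterm (m := m) (by omega)).1) fun m => (hterm (by omega)).2
  set A : ℕ → ℝ := fun k => ∑' m, pathTerm q z (m + k) m with hA
  set B : ℕ → ℝ := fun k => ∑' m, pathTerm q z m (m + k) with hB
  have hAM (k : ℕ) : |A k| ≤ ∑' m : ℕ, ((2 * z) ^ 2) ^ m := by
    rw [abs_of_nonneg (tsum_nonneg fun m => (hterm (m := m) (by omega)).1)]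
    exact (hsA k).tsum_le_tsum (fun m => (hterm (by omega)).2) hgeo
  have hBM (k : ℕ) : |B k| ≤ ∑' m : ℕ, ((2 * z) ^ 2) ^ m := by
    rw [abs_of_nonneg (tsum_nonneg fun m => (hterm (m := m) (by omega)).1)]
    exact (hsB k).tsum_le_tsum (fun m => (hterm (by omega)).2) hgeo
  have hArec (k : ℕ) : A (k + 1) = (if k < 2 then q else 1) * z * A k + z * A (k + 2) :=
    tsum_eq_of_shift (hsA _) (hsA _) (hsA _) (by simpa using pathTerm_right q z k)
      (pathTerm_right_succ q z k)
  have hBrec (k : ℕ) : B (k + 1) = z * B k + z * B (k + 2) :=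
    tsum_eq_of_shift (hsB _) (hsB _) (hsB _) (by simpa using pathTerm_left q z k)
      (pathTerm_left_succ q z k)
  have hA0 : A 0 = 1 + z * B 1 + z * A 1 := by
    simp only [hA, hB]
    rw [(hsA 0).tsum_eq_zero_add]
    simp only [add_zero, pathTerm_zero_zero, pathTerm_diag_succ]
    rw [((hsB 1).mul_left z).tsum_add ((hsA 1).mul_left z), tsum_mul_left, tsum_mul_left]
    ring
  have hB0 : B 0 = A 0 := rfl
  rw [hdiag]
  refine ⟨hsA 0, ?_⟩
  change A 0 = _
  obtain ⟨hz0, hz1⟩ := hz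
  obtain ⟨hq0, hq1⟩ := hq
  have hz4 : 0 < 1 - 4 * z ^ 2 := by nlinarith
  have hPhalf : Pgf (z ^ 2) < 1 / 2 := by
    have := Real.sqrt_pos.2 hz4
    unfold Pgf; linarith
  have hP : Pgf (z ^ 2) * (1 - Pgf (z ^ 2)) = z ^ 2 := by
    have := Real.sq_sqrt hz4.le
    unfold Pgf; linear_combination -this / 4
  generalize Pgf (z ^ 2) = P at hPhalf hP ⊢
  have hP0 : 0 < P := pos_of_mul_pos_left (hP ▸ pow_pos hz0 2) (by linarith)
  have hB1 := mul_eq_of_bounded_recurrence hz0 (by linarith) hP hBM hBrec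
  have hA3 : z * A 3 = P * A 2 :=
    mul_eq_of_bounded_recurrence hz0 (by linarith) hP (a := fun k => A (k + 2))
      (fun k => hAM (k + 2)) fun k => by simpa using hArec (k + 2)
  have hA1 : A 1 = q * z * A 0 + z * A 2 := by simpa using hArec 0
  have hA2 : A 2 = q * z * A 1 + z * A 3 := by simpa using hArec 1
  have hP1 : 0 < 1 - P := by linarith
  have hzA2 : z * A 2 = q * P * A 1 := by
    refine mul_left_cancel₀ hP1.ne' ?_
    linear_combination z * hA2 + z * hA3 - q * A 1 * hP
  have hden : 0 < 1 - 2 * q * P := by nlinarith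
  have hkey : A 0 * ((1 - P) * (1 - 2 * q * P)) = 1 - q * P := by
    linear_combination (1 - q * P) * (hA0 + hB1 + P * hB0) + z * (hA1 + hzA2) - q * A 0 * hP
  rw [eq_div_iff (by positivity), ← hP]
  linear_combination P * hkey
end

section
/- Let z ∈ (0,1/2). Then Σ_{m1≥0} Σ_{m2≥0} g'_{m1,m2}(1)·z^{m1+m2} = (P(z²) + z) / ((1−2z)·(1 − 2P(z²))), where g'_{m1,m2}(1) denotes the derivative of the polynomial g_{m1,m2}(q) with respect to q evaluated at q = 1. -/
open Finset.HasAntidiagonal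

/-- At `q = 1` the polynomial `g_{a,b}` is a binomial coefficient. -/
lemma gP_eval_one (a b : ℕ) : (gP a b).eval 1 = ((a + b).choose a : ℝ) := by
  fun_induction gP a b with
  | case1 => simp
  | case2 b ih => simpa using ih
  | case3 a ih =>
    simp only [Polynomial.eval_mul, Polynomial.eval_pow, Polynomial.eval_X, one_pow, one_mul, ih]
    simp
  | case4 a b ih₁ ih₂ =>
    simp only [Polynomial.eval_add, Polynomial.eval_mul, Polynomial.eval_pow, Polynomial.eval_X,
      one_pow, one_mul, ih₁, ih₂]
    rw [show a + 1 + (b + 1) = (a + (b + 1)) + 1 by ring, Nat.choose_succ_succ,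
      show a + 1 + b = a + (b + 1) by ring]
    push_cast
    rfl

/-- The derivative of `g_{a,b}` at `q = 1`. -/
noncomputable def gDeriv (a b : ℕ) : ℝ := (Polynomial.derivative (gP a b)).eval 1

/-- The contribution to the derivative of `g_{a+1,b}` at `q = 1` of the factor `q^δ`
in the recurrence. -/
noncomputable def gJump (a b : ℕ) : ℝ :=
  if (a + 1 + b) / 2 = a then ((a + b).choose a : ℝ) else 0

lemma gDeriv_zero_zero : gDeriv 0 0 = 0 := by simp [gDeriv, gP]

lemma gDeriv_zero_succ (b : ℕ) : gDeriv 0 (b + 1) = gDeriv 0 b := by simp [gDeriv, gP]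

lemma gDeriv_succ_zero (a : ℕ) : gDeriv (a + 1) 0 = gDeriv a 0 + gJump a 0 := by
  simp only [gDeriv, gP, gJump]
  split_ifs <;> first | omega | simp [gP_eval_one, add_comm]

lemma gDeriv_succ_succ (a b : ℕ) :
    gDeriv (a + 1) (b + 1) = gDeriv a (b + 1) + gJump a (b + 1) + gDeriv (a + 1) b := by
  simp only [gDeriv, gP, gJump]
  split_ifs <;> first | omega | simp [gP_eval_one, add_comm]

lemma gDeriv_nonneg (a b : ℕ) : 0 ≤ gDeriv a b := by
  have hJ (a b : ℕ) : 0 ≤ gJump a b := by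
    unfold gJump
    positivity
  induction a generalizing b with
  | zero =>
    induction b with
    | zero => simp [gDeriv_zero_zero]
    | succ b ih => rwa [gDeriv_zero_succ]
  | succ a iha =>
    induction b with
    | zero =>
      rw [gDeriv_succ_zero]
      exact add_nonneg (iha 0) (hJ a 0)
    | succ b ihb =>
      rw [gDeriv_succ_succ]
      exact add_nonneg (add_nonneg (iha _) (hJ a _)) ihb

lemma sum_antidiagonal_gJump (n : ℕ) :
    ∑ p ∈ antidiagonal n, gJump p.1 p.2 = (n.choose ((n + 1) / 2) : ℝ) := by
  rw [Finset.sum_eq_single ((n + 1) / 2, n - (n + 1) / 2)]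
  · have h : (n + 1) / 2 + (n - (n + 1) / 2) = n := by omega
    rw [gJump, if_pos (by dsimp only; omega), h]
  · rintro ⟨a, b⟩ hp hne
    rw [mem_antidiagonal] at hp
    refine if_neg fun h => hne ?_
    simp only [Prod.mk.injEq] at hp h ⊢
    omega
  · intro h
    exact absurd (mem_antidiagonal.2 (by dsimp only; omega)) h

lemma sum_antidiagonal_gDeriv_succ (n : ℕ) :
    ∑ p ∈ antidiagonal (n + 1), gDeriv p.1 p.2 =
      2 * ∑ p ∈ antidiagonal n, gDeriv p.1 p.2 + (n.choose ((n + 1) / 2) : ℝ) := by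
  let L : ℕ × ℕ → ℝ := fun p => Nat.casesOn p.1 0 fun a => gDeriv a p.2 + gJump a p.2
  let R : ℕ × ℕ → ℝ := fun p => Nat.casesOn p.2 0 fun b => gDeriv p.1 b
  have h : ∀ p ∈ antidiagonal (n + 1), gDeriv p.1 p.2 = L p + R p := by
    rintro ⟨_ | a, _ | b⟩ hp
    · simp at hp
    · simp [L, R, gDeriv_zero_succ]
    · simp [L, R, gDeriv_succ_zero]
    · simp [L, R, gDeriv_succ_succ]
  rw [Finset.sum_congr rfl h, Finset.sum_add_distrib, Finset.Nat.sum_antidiagonal_succ, Finset.Nat.sum_antidiagonal_succ',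
    ← sum_antidiagonal_gJump, show L (0, n + 1) = 0 from rfl, show R (n + 1, 0) = 0 from rfl]
  simp only [L, R, Finset.sum_add_distrib]
  ring

/-- The sums over antidiagonals, solved as a convolution with powers of two. -/
lemma sum_antidiagonal_gDeriv (n : ℕ) :
    ∑ p ∈ antidiagonal (n + 1), gDeriv p.1 p.2 =
      ∑ p ∈ antidiagonal n, (2 : ℝ) ^ p.1 * (p.2.choose ((p.2 + 1) / 2) : ℝ) := by
  induction n with
  | zero => simp [sum_antidiagonal_gDeriv_succ, gDeriv_zero_zero]
  | succ n ih =>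
    rw [sum_antidiagonal_gDeriv_succ, ih, Finset.Nat.sum_antidiagonal_succ, Finset.mul_sum]
    simp only [pow_succ', mul_assoc, pow_zero, one_mul]
    ring

lemma four_pow_mul_multichoose_half (n : ℕ) :
    4 ^ n * Ring.multichoose (1 / 2 : ℝ) n = n.centralBinom := by
  have h (k : ℕ) := Ring.factorial_nsmul_multichoose_eq_ascPochhammer (1 / 2 : ℝ) k
  simp only [Polynomial.ascPochhammer_smeval_eq_eval, nsmul_eq_mul] at h
  induction n with
  | zero => simp
  | succ n ih =>
    have h₁ := h (n + 1)
    rw [ascPochhammer_succ_eval, ← h n, Nat.factorial_succ] at h₁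
    have h₂ : ((n : ℝ) + 1) * (n + 1).centralBinom = 2 * (2 * n + 1) * n.centralBinom := by
      exact_mod_cast n.succ_mul_centralBinom_succ
    have hf : (n.factorial : ℝ) ≠ 0 := by positivity
    have hn : (n : ℝ) + 1 ≠ 0 := by positivity
    refine mul_left_cancel₀ (mul_ne_zero hn hf) ?_
    push_cast at h₁
    rw [← ih] at h₂
    linear_combination 4 ^ (n + 1) * h₁ - (n.factorial : ℝ) * h₂

/-- The generating function of the central binomial coefficients. -/
lemma hasSum_centralBinom {x : ℝ} (hx : |x| < 1 / 4) :
    HasSum (fun n : ℕ => (n.centralBinom : ℝ) * x ^ n) (1 / √(1 - 4 * x)) := by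
  have hmem : 4 * x ∈ Metric.eball (0 : ℝ) 1 := by
    rw [← ENNReal.ofReal_one, Metric.eball_ofReal, mem_ball_zero_iff, Real.norm_eq_abs, abs_mul]
    norm_num
    linarith
  have h := (Real.one_div_one_sub_rpow_hasFPowerSeriesOnBall_zero (1 / 2)).hasSum hmem
  simp only [FormalMultilinearSeries.ofScalars_apply_eq, smul_eq_mul, zero_add,
    ← Ring.multichoose_eq, ← Real.sqrt_eq_rpow] at h
  refine h.congr_fun fun n => ?_
  rw [← four_pow_mul_multichoose_half, mul_pow]
  ring

lemma hasSum_choose_half {z : ℝ} (hz : z ∈ Set.Ioo (0 : ℝ) (1 / 2)) :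
    HasSum (fun n : ℕ => (n.choose ((n + 1) / 2) : ℝ) * z ^ (n + 1))
      ((Pgf (z ^ 2) + z) / (1 - 2 * Pgf (z ^ 2))) := by
  obtain ⟨h0, h1⟩ := hz
  have hx : |z ^ 2| < 1 / 4 := by
    rw [abs_of_nonneg (sq_nonneg z)]
    nlinarith
  have hc := hasSum_centralBinom hx
  have hs : 0 < √(1 - 4 * z ^ 2) := Real.sqrt_pos.2 (by nlinarith)
  have heven := hc.mul_left z
  have hodd := (((hasSum_nat_add_iff' 1).2 hc).mul_left (1 / 2))
  convert HasSum.even_add_odd (f := fun n : ℕ => (n.choose ((n + 1) / 2) : ℝ) * z ^ (n + 1))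
    (heven.congr_fun ?_) (hodd.congr_fun ?_) using 1
  · have hP : 1 - 2 * Pgf (z ^ 2) = √(1 - 4 * z ^ 2) := by
      unfold Pgf
      ring
    rw [hP, Pgf, Finset.sum_range_one, Nat.centralBinom_zero]
    field_simp
    ring
  · intro k
    rw [show (2 * k + 1) / 2 = k by omega, ← Nat.centralBinom_eq_two_mul_choose]
    ring
  · intro k
    have h : (k + 1).centralBinom = 2 * (2 * k + 1).choose (k + 1) := by
      rw [Nat.centralBinom_eq_two_mul_choose, show 2 * (k + 1) = 2 * k + 1 + 1 by ring,
        Nat.choose_succ_succ, ← Nat.choose_symm_half]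
      ring
    rw [h, show (2 * k + 1 + 1) / 2 = k + 1 by omega]
    push_cast
    ring

theorem stmt4 (z : ℝ) (hz : z ∈ Set.Ioo (0 : ℝ) (1 / 2)) :
    Summable (fun p : ℕ × ℕ =>
      (Polynomial.derivative (gP p.1 p.2)).eval 1 * z ^ (p.1 + p.2)) ∧
    ∑' p : ℕ × ℕ, (Polynomial.derivative (gP p.1 p.2)).eval 1 * z ^ (p.1 + p.2)
      = (Pgf (z ^ 2) + z) / ((1 - 2 * z) * (1 - 2 * Pgf (z ^ 2))) := by
  have hF := hasSum_choose_half hz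
  obtain ⟨h0, h1⟩ := hz
  have hG : HasSum (fun n : ℕ => (2 * z) ^ n) (1 - 2 * z)⁻¹ :=
    hasSum_geometric_of_lt_one (by linarith) (by linarith)
  have hS : HasSum (fun n : ℕ => ∑ p ∈ antidiagonal n, gDeriv p.1 p.2 * z ^ (p.1 + p.2))
      ((Pgf (z ^ 2) + z) / ((1 - 2 * z) * (1 - 2 * Pgf (z ^ 2)))) := by
    rw [← hasSum_nat_add_iff' 1]
    have hsum := (summable_norm_sum_mul_antidiagonal_of_summable_norm hG.summable.norm
      hF.summable.norm).of_norm.hasSum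
    rw [← tsum_mul_tsum_eq_tsum_sum_antidiagonal_of_summable_norm hG.summable.norm
      hF.summable.norm, hG.tsum_eq, hF.tsum_eq] at hsum
    convert hsum using 1
    · ext n
      rw [Finset.sum_congr rfl fun p hp => by rw [mem_antidiagonal.1 hp],
        ← Finset.sum_mul, sum_antidiagonal_gDeriv, Finset.sum_mul]
      refine Finset.sum_congr rfl fun p hp => ?_
      rw [← mem_antidiagonal.1 hp]
      ring
    · simp [gDeriv_zero_zero, div_eq_mul_inv]
      ring
  let e := Finset.HasAntidiagonal.sigmaAntidiagonalEquivProd (A := ℕ)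
  have hfiber (n : ℕ) : HasSum (fun p : antidiagonal n =>
      gDeriv (p : ℕ × ℕ).1 (p : ℕ × ℕ).2 * z ^ ((p : ℕ × ℕ).1 + (p : ℕ × ℕ).2))
      (∑ p ∈ antidiagonal n, gDeriv p.1 p.2 * z ^ (p.1 + p.2)) :=
    Finset.hasSum _ _
  have hsummable : Summable (fun x : (n : ℕ) × antidiagonal n =>
      gDeriv (x.2 : ℕ × ℕ).1 (x.2 : ℕ × ℕ).2 * z ^ ((x.2 : ℕ × ℕ).1 + (x.2 : ℕ × ℕ).2)) := by
    refine (summable_sigma_of_nonneg fun x => mul_nonneg (gDeriv_nonneg _ _) (by positivity)).2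
      ⟨fun n => (hfiber n).summable, ?_⟩
    simpa only [(hfiber _).tsum_eq] using hS.summable
  have htotal : HasSum (fun p : ℕ × ℕ => gDeriv p.1 p.2 * z ^ (p.1 + p.2))
      ((Pgf (z ^ 2) + z) / ((1 - 2 * z) * (1 - 2 * Pgf (z ^ 2)))) := by
    rw [← e.hasSum_iff, ← (hsummable.hasSum.sigma hfiber).unique hS]
    exact hsummable.hasSum
  exact ⟨htotal.summable, htotal.tsum_eq⟩
end

section
/- Let s ≥ 2 be an integer and z ∈ (0,1/2). Then Σ_{m1≥0} Σ_{m2≥0} (g^{(s)}_{m1,m2}(1)/s!)·z^{m1+m2} = ((z+1)·P(z²) − z²)·(2P(z²))^{s−2} / (z·(1−2z)·(1 − 2P(z²))^{s}), where g^{(s)}_{m1,m2}(1) denotes the s-th derivative of the polynomial g_{m1,m2}(q) with respect to q evaluated at q = 1 (equivalently, g^{(s)}_{m1,m2}(1)/s! is the coefficient of w^s in g_{m1,m2}(1+w)). -/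
open Polynomial in
/-- Generating polynomial of the `±1` walks of length `n` started at `i`, where `X` marks the up
steps leaving `0` or `1`. -/
noncomputable def walkPoly : ℕ → ℤ → ℝ[X]
  | 0, _ => 1
  | n + 1, i => X ^ (if i = 0 ∨ i = 1 then 1 else 0) * walkPoly n (i + 1) + walkPoly n (i - 1)

open Polynomial in
theorem sum_antidiagonal_gP_mul_walkPoly_succ (n k : ℕ) :
    ∑ p ∈ Finset.HasAntidiagonal.antidiagonal (n + 1), gP p.1 p.2 * walkPoly k ((p.1 : ℤ) - p.2) =
      ∑ p ∈ Finset.HasAntidiagonal.antidiagonal n,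
        gP p.1 p.2 * walkPoly (k + 1) ((p.1 : ℤ) - p.2) := by
  let L : ℕ → ℕ → ℝ[X] := fun a b => match a with
    | 0 => 0
    | a + 1 => X ^ (if (a + 1 + b) / 2 + 1 = a + 1 then 1 else 0) * gP a b
  let R : ℕ → ℕ → ℝ[X] := fun a b => match b with
    | 0 => 0
    | b + 1 => gP a b
  have hLR : ∀ p ∈ Finset.HasAntidiagonal.antidiagonal (n + 1),
      gP p.1 p.2 * walkPoly k ((p.1 : ℤ) - p.2) =
        L p.1 p.2 * walkPoly k ((p.1 : ℤ) - p.2) + R p.1 p.2 * walkPoly k ((p.1 : ℤ) - p.2) := by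
    rintro ⟨a, b⟩ hp
    rw [← add_mul]
    congr 1
    rcases a with _ | a <;> rcases b with _ | b
    · simp at hp
    all_goals simp [L, R, gP]
  rw [Finset.sum_congr rfl hLR, Finset.sum_add_distrib,
    Finset.Nat.sum_antidiagonal_succ (f := fun p : ℕ × ℕ =>
      L p.1 p.2 * walkPoly k ((p.1 : ℤ) - p.2)),
    Finset.Nat.sum_antidiagonal_succ' (f := fun p : ℕ × ℕ =>
      R p.1 p.2 * walkPoly k ((p.1 : ℤ) - p.2))]
  simp only [L, R, zero_mul, zero_add]
  rw [← Finset.sum_add_distrib]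
  refine Finset.sum_congr rfl fun p _ => ?_
  obtain ⟨a, b⟩ := p
  have hδ : (a + 1 + b) / 2 + 1 = a + 1 ↔ ((a : ℤ) - b = 0 ∨ (a : ℤ) - b = 1) := by omega
  have hup : ((a + 1 : ℕ) : ℤ) - b = (a : ℤ) - b + 1 := by push_cast; ring
  have hdown : (a : ℤ) - ((b + 1 : ℕ) : ℤ) = (a : ℤ) - b - 1 := by push_cast; ring
  simp only [walkPoly, hδ, hup, hdown]
  ring

theorem sum_antidiagonal_gP (n : ℕ) :
    ∑ p ∈ Finset.HasAntidiagonal.antidiagonal n, gP p.1 p.2 = walkPoly n 0 := by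
  have key : ∀ n k : ℕ, ∑ p ∈ Finset.HasAntidiagonal.antidiagonal n,
      gP p.1 p.2 * walkPoly k ((p.1 : ℤ) - p.2) =
      walkPoly (n + k) 0 := by
    intro n
    induction n with
    | zero => intro k; simp [gP]
    | succ n ih =>
      intro k
      rw [sum_antidiagonal_gP_mul_walkPoly_succ, ih, add_right_comm, add_assoc]
  simpa [walkPoly] using key n 0

open Polynomial in
theorem taylor_one_coeff_zero_X_mul (p : ℝ[X]) :
    (taylor 1 (X * p)).coeff 0 = (taylor 1 p).coeff 0 := by
  simp [taylor_coeff_zero]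

open Polynomial in
theorem taylor_one_coeff_succ_X_mul (p : ℝ[X]) (s : ℕ) :
    (taylor 1 (X * p)).coeff (s + 1) = (taylor 1 p).coeff (s + 1) + (taylor 1 p).coeff s := by
  rw [taylor_mul, taylor_X, add_mul, coeff_add, coeff_X_mul, coeff_C_mul, one_mul, add_comm]

open Polynomial in
theorem eval_one_iterate_derivative_div_factorial (p : ℝ[X]) (s : ℕ) :
    (derivative^[s] p).eval 1 / (s.factorial : ℝ) = (taylor 1 p).coeff s := by
  rw [taylor_coeff, ← factorial_smul_hasseDeriv, LinearMap.smul_apply, eval_smul, nsmul_eq_mul,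
    mul_div_cancel_left₀ _ (by positivity)]

open Polynomial in
theorem taylor_one_coeff_gP_nonneg (a b : ℕ) (s : ℕ) : 0 ≤ (taylor 1 (gP a b)).coeff s := by
  have hX : ∀ (P : Prop) [Decidable P] (p : ℝ[X]), (∀ s, 0 ≤ (taylor 1 p).coeff s) →
      ∀ s, 0 ≤ (taylor 1 (X ^ (if P then 1 else 0) * p)).coeff s := by
    intro P _ p hp s
    split_ifs
    · rw [pow_one]
      cases s with
      | zero => rw [taylor_one_coeff_zero_X_mul]; exact hp 0
      | succ s => rw [taylor_one_coeff_succ_X_mul]; exact add_nonneg (hp _) (hp _)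
    · simpa using hp s
  induction a, b using gP.induct generalizing s with
  | case1 => simp only [gP, taylor_one, coeff_C]; split_ifs <;> norm_num
  | case2 b ih => simpa only [gP] using ih s
  | case3 a ih => rw [gP]; exact hX _ _ ih s
  | case4 a b ih₁ ih₂ =>
    rw [gP, map_add, coeff_add]
    exact add_nonneg (hX _ _ ih₁ s) (ih₂ s)

open Polynomial in
/-- The `s`-th Taylor coefficient at `1` of `walkPoly n i`. -/
noncomputable def walkCoeff (s n : ℕ) (i : ℤ) : ℝ := (taylor 1 (walkPoly n i)).coeff s

theorem walkCoeff_zero_left (n : ℕ) (i : ℤ) : walkCoeff 0 n i = 2 ^ n := by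
  induction n generalizing i with
  | zero => simp [walkCoeff, walkPoly]
  | succ n ih =>
    have h₁ := ih (i + 1)
    have h₂ := ih (i - 1)
    simp only [walkCoeff, Polynomial.taylor_coeff_zero] at h₁ h₂
    simp only [walkCoeff, walkPoly, Polynomial.taylor_coeff_zero, Polynomial.eval_add,
      Polynomial.eval_mul, Polynomial.eval_pow, Polynomial.eval_X, one_pow, h₁, h₂]
    ring

theorem walkCoeff_succ_zero (s : ℕ) (i : ℤ) : walkCoeff (s + 1) 0 i = 0 := by
  simp [walkCoeff, walkPoly, Polynomial.coeff_one]

theorem walkCoeff_succ_succ (s n : ℕ) (i : ℤ) :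
    walkCoeff (s + 1) (n + 1) i = walkCoeff (s + 1) n (i + 1)
      + (if i = 0 ∨ i = 1 then walkCoeff s n (i + 1) else 0) + walkCoeff (s + 1) n (i - 1) := by
  simp only [walkCoeff, walkPoly, map_add, Polynomial.coeff_add]
  split_ifs
  · rw [pow_one, taylor_one_coeff_succ_X_mul]
  · simp

theorem walkCoeff_nonneg (s n : ℕ) (i : ℤ) : 0 ≤ walkCoeff s n i := by
  induction n generalizing s i with
  | zero =>
    cases s with
    | zero => simp [walkCoeff_zero_left]
    | succ s => rw [walkCoeff_succ_zero]
  | succ n ih =>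
    cases s with
    | zero => rw [walkCoeff_zero_left]; positivity
    | succ s =>
      rw [walkCoeff_succ_succ]
      have := ih s (i + 1)
      have := ih (s + 1) (i + 1)
      have := ih (s + 1) (i - 1)
      split_ifs <;> linarith

theorem walkCoeff_le (s n : ℕ) (i : ℤ) : walkCoeff s n i ≤ n.choose s * 2 ^ n := by
  induction n generalizing s i with
  | zero =>
    cases s with
    | zero => simp [walkCoeff_zero_left]
    | succ s => simp [walkCoeff_succ_zero]
  | succ n ih =>
    cases s with
    | zero => simp [walkCoeff_zero_left]
    | succ s =>
      rw [walkCoeff_succ_succ, Nat.choose_succ_succ, pow_succ]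
      push_cast
      have := ih s (i + 1)
      have := ih (s + 1) (i + 1)
      have := ih (s + 1) (i - 1)
      have : (0 : ℝ) ≤ n.choose s * 2 ^ n := by positivity
      split_ifs <;> linarith

theorem summable_choose_mul_two_pow_mul_pow (s : ℕ) {z : ℝ} (hz : z ∈ Set.Ioo (0 : ℝ) (1 / 2)) :
    Summable fun n : ℕ => (n.choose s : ℝ) * 2 ^ n * z ^ n := by
  have hr : ‖2 * z‖ < 1 := by
    rw [Real.norm_of_nonneg (by linarith [hz.1])]; linarith [hz.2]
  have h := (summable_choose_mul_geometric_of_norm_lt_one s hr).mul_left ((2 * z) ^ s)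
  rw [← summable_nat_add_iff s]
  refine h.congr fun n => ?_
  rw [mul_assoc, ← mul_pow, pow_add]
  ring

theorem summable_walkCoeff_mul_pow (s : ℕ) (i : ℤ) {z : ℝ} (hz : z ∈ Set.Ioo (0 : ℝ) (1 / 2)) :
    Summable fun n : ℕ => walkCoeff s n i * z ^ n :=
  Summable.of_nonneg_of_le
    (fun n => mul_nonneg (walkCoeff_nonneg s n i) (pow_nonneg hz.1.le n))
    (fun n => mul_le_mul_of_nonneg_right (walkCoeff_le s n i) (pow_nonneg hz.1.le n))
    (summable_choose_mul_two_pow_mul_pow s hz)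

/-- The generating function of `walkCoeff s n i` in the length `n`. -/
noncomputable def walkGF (z : ℝ) (s : ℕ) (i : ℤ) : ℝ := ∑' n : ℕ, walkCoeff s n i * z ^ n

theorem exists_abs_walkGF_le (s : ℕ) {z : ℝ} (hz : z ∈ Set.Ioo (0 : ℝ) (1 / 2)) :
    ∃ B, ∀ i, |walkGF z s i| ≤ B := by
  refine ⟨∑' n : ℕ, (n.choose s : ℝ) * 2 ^ n * z ^ n, fun i => ?_⟩
  rw [walkGF, abs_of_nonneg
    (tsum_nonneg fun n => mul_nonneg (walkCoeff_nonneg s n i) (pow_nonneg hz.1.le n))]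
  exact (summable_walkCoeff_mul_pow s i hz).tsum_le_tsum
    (fun n => mul_le_mul_of_nonneg_right (walkCoeff_le s n i) (pow_nonneg hz.1.le n))
    (summable_choose_mul_two_pow_mul_pow s hz)

theorem walkGF_zero_left (i : ℤ) {z : ℝ} (hz : z ∈ Set.Ioo (0 : ℝ) (1 / 2)) :
    walkGF z 0 i = (1 - 2 * z)⁻¹ := by
  simp only [walkGF, walkCoeff_zero_left, ← mul_pow]
  exact tsum_geometric_of_lt_one (by linarith [hz.1]) (by linarith [hz.2])

theorem walkGF_succ (s : ℕ) (i : ℤ) {z : ℝ} (hz : z ∈ Set.Ioo (0 : ℝ) (1 / 2)) :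
    walkGF z (s + 1) i = z * (walkGF z (s + 1) (i + 1)
      + (if i = 0 ∨ i = 1 then walkGF z s (i + 1) else 0) + walkGF z (s + 1) (i - 1)) := by
  have h₁ := (summable_walkCoeff_mul_pow (s + 1) (i + 1) hz).hasSum
  have h₂ := (summable_walkCoeff_mul_pow s (i + 1) hz).hasSum
  have h₃ := (summable_walkCoeff_mul_pow (s + 1) (i - 1) hz).hasSum
  have h₂' : HasSum (fun n : ℕ => (if i = 0 ∨ i = 1 then walkCoeff s n (i + 1) else 0) * z ^ n)
      (if i = 0 ∨ i = 1 then walkGF z s (i + 1) else 0) := by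
    split_ifs
    · exact h₂
    · simp
  rw [walkGF, (summable_walkCoeff_mul_pow (s + 1) i hz).tsum_eq_zero_add, walkCoeff_succ_zero,
    zero_mul, zero_add]
  refine HasSum.tsum_eq ?_
  refine (((h₁.add h₂').add h₃).mul_left z).congr_fun fun n => ?_
  rw [walkCoeff_succ_succ]
  ring

/-- A bounded solution of `x (k + 1) = z * (x (k + 2) + x k)` decays geometrically. -/
theorem eq_div_mul_of_bounded_of_recurrence {z P B : ℝ} (hz : 0 < z) (hP : 0 < P) (hPz : P < z)
    (hquad : P = z ^ 2 + P ^ 2) {x : ℕ → ℝ} (hB : ∀ k, |x k| ≤ B)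
    (hx : ∀ k, x (k + 1) = z * (x (k + 2) + x k)) : z * x 1 = P * x 0 := by
  set r := P / z with hr
  have hr0 : 0 ≤ r := by positivity
  have hr1 : r < 1 := by rwa [hr, div_lt_one hz]
  have hzr : z * r = P := by rw [hr]; field_simp
  have hd : ∀ k, x 1 - r * x 0 = r ^ k * (x (k + 1) - r * x k) := by
    intro k
    induction k with
    | zero => simp
    | succ k ih =>
      rw [ih, pow_succ, mul_assoc]
      congr 1
      have hrP : z = r * (1 - P) := by rw [hr]; field_simp; linarith
      have h := hx k
      have : z * (x (k + 1) - r * x k) = z * (r * (x (k + 1 + 1) - r * x (k + 1))) := by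
        have e : x (k + 1 + 1) = x (k + 2) := rfl
        rw [e]
        linear_combination r * h + x (k + 1) * hrP + r * x (k + 1) * hzr
      exact mul_left_cancel₀ hz.ne' this
  have hlim : Filter.Tendsto (fun k : ℕ => r ^ k * (2 * B)) Filter.atTop (nhds 0) := by
    simpa using (tendsto_pow_atTop_nhds_zero_of_lt_one hr0 hr1).mul_const (2 * B)
  have hle : |x 1 - r * x 0| ≤ 0 := by
    refine ge_of_tendsto' hlim fun k => ?_
    rw [hd k, abs_mul, abs_of_nonneg (pow_nonneg hr0 k)]
    refine mul_le_mul_of_nonneg_left ?_ (pow_nonneg hr0 k)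
    calc |x (k + 1) - r * x k| ≤ |x (k + 1)| + |r * x k| := abs_sub _ _
      _ ≤ B + 1 * B := by
          rw [abs_mul, abs_of_nonneg hr0]
          exact add_le_add (hB _) (mul_le_mul hr1.le (hB _) (abs_nonneg _) zero_le_one)
      _ = 2 * B := by ring
  have h0 : x 1 - r * x 0 = 0 := abs_nonpos_iff.mp hle
  linear_combination z * h0 + x 0 * hzr

theorem Pgf_sq_props {z : ℝ} (hz : z ∈ Set.Ioo (0 : ℝ) (1 / 2)) :
    0 < Pgf (z ^ 2) ∧ Pgf (z ^ 2) < z ∧ Pgf (z ^ 2) = z ^ 2 + Pgf (z ^ 2) ^ 2 := by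
  obtain ⟨h0, h1⟩ := hz
  have hsq : Real.sqrt (1 - 4 * z ^ 2) ^ 2 = 1 - 4 * z ^ 2 := Real.sq_sqrt (by nlinarith)
  have hnn := Real.sqrt_nonneg (1 - 4 * z ^ 2)
  unfold Pgf
  refine ⟨?_, ?_, ?_⟩ <;> nlinarith

theorem mul_walkGF_two (s : ℕ) {z : ℝ} (hz : z ∈ Set.Ioo (0 : ℝ) (1 / 2)) :
    z * walkGF z (s + 1) 2 = Pgf (z ^ 2) * walkGF z (s + 1) 1 := by
  obtain ⟨hP, hPz, hquad⟩ := Pgf_sq_props hz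
  obtain ⟨B, hB⟩ := exists_abs_walkGF_le (s + 1) hz
  refine eq_div_mul_of_bounded_of_recurrence (x := fun k : ℕ => walkGF z (s + 1) ((k : ℤ) + 1))
    hz.1 hP hPz hquad (fun k => hB _) fun k => ?_
  have h := walkGF_succ s ((k : ℤ) + 2) hz
  rw [if_neg (by omega), add_zero] at h
  rw [show ((k + 1 : ℕ) : ℤ) + 1 = k + 2 by push_cast; ring,
    show ((k + 2 : ℕ) : ℤ) + 1 = k + 2 + 1 by push_cast; ring, h,
    show (k : ℤ) + 2 - 1 = k + 1 by ring]

theorem mul_walkGF_neg_one (s : ℕ) {z : ℝ} (hz : z ∈ Set.Ioo (0 : ℝ) (1 / 2)) :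
    z * walkGF z (s + 1) (-1) = Pgf (z ^ 2) * walkGF z (s + 1) 0 := by
  obtain ⟨hP, hPz, hquad⟩ := Pgf_sq_props hz
  obtain ⟨B, hB⟩ := exists_abs_walkGF_le (s + 1) hz
  refine eq_div_mul_of_bounded_of_recurrence (x := fun k : ℕ => walkGF z (s + 1) (-(k : ℤ)))
    hz.1 hP hPz hquad (fun k => hB _) fun k => ?_
  have h := walkGF_succ s (-(k : ℤ) - 1) hz
  rw [if_neg (by omega), add_zero, sub_add_cancel] at h
  rw [show -((k + 1 : ℕ) : ℤ) = -k - 1 by push_cast; ring,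
    show -((k + 2 : ℕ) : ℤ) = -k - 1 - 1 by push_cast; ring, h, add_comm]

theorem mul_walkGF_succ_zero (s : ℕ) {z : ℝ} (hz : z ∈ Set.Ioo (0 : ℝ) (1 / 2)) :
    z * walkGF z (s + 1) 0 = Pgf (z ^ 2) * (walkGF z (s + 1) 1 + walkGF z s 1) := by
  obtain ⟨hP, hPz, hquad⟩ := Pgf_sq_props hz
  have h := walkGF_succ s 0 hz
  have hneg := mul_walkGF_neg_one s hz
  simp only [true_or, if_true, zero_add, zero_sub] at h
  have hne : 1 - Pgf (z ^ 2) ≠ 0 := by linarith [hz.2]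
  refine mul_left_cancel₀ hne ?_
  linear_combination z * h + z * hneg - (walkGF z (s + 1) 1 + walkGF z s 1) * hquad

theorem mul_walkGF_succ_one (s : ℕ) {z : ℝ} (hz : z ∈ Set.Ioo (0 : ℝ) (1 / 2)) :
    (1 - 2 * Pgf (z ^ 2)) * walkGF z (s + 1) 1 =
      z * walkGF z s 2 + Pgf (z ^ 2) * walkGF z s 1 := by
  have h := walkGF_succ s 1 hz
  have h2 := mul_walkGF_two s hz
  have h0 := mul_walkGF_succ_zero s hz
  norm_num at h
  linear_combination h + h2 + h0

theorem walkGF_succ_one (s : ℕ) {z : ℝ} (hz : z ∈ Set.Ioo (0 : ℝ) (1 / 2)) :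
    walkGF z (s + 1) 1 = (z + Pgf (z ^ 2)) * (2 * Pgf (z ^ 2)) ^ s /
      ((1 - 2 * z) * (1 - 2 * Pgf (z ^ 2)) ^ (s + 1)) := by
  obtain ⟨hP, hPz, hquad⟩ := Pgf_sq_props hz
  have hne : 1 - 2 * Pgf (z ^ 2) ≠ 0 := by linarith [hz.2]
  have hne' : 1 - 2 * z ≠ 0 := by linarith [hz.2]
  refine mul_left_cancel₀ hne ?_
  rw [mul_walkGF_succ_one s hz]
  induction s with
  | zero =>
    rw [walkGF_zero_left _ hz, walkGF_zero_left _ hz]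
    field_simp
    ring
  | succ s ih =>
    rw [mul_walkGF_two s hz, ← two_mul, ← mul_assoc,
      mul_left_cancel₀ hne ((mul_walkGF_succ_one s hz).trans ih)]
    field_simp
    ring

theorem walkGF_add_two_zero (s : ℕ) {z : ℝ} (hz : z ∈ Set.Ioo (0 : ℝ) (1 / 2)) :
    walkGF z (s + 2) 0 = ((z + 1) * Pgf (z ^ 2) - z ^ 2) * (2 * Pgf (z ^ 2)) ^ s
        / (z * (1 - 2 * z) * (1 - 2 * Pgf (z ^ 2)) ^ (s + 2)) := by
  obtain ⟨hP, hPz, hquad⟩ := Pgf_sq_props hz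
  have hne : 1 - 2 * Pgf (z ^ 2) ≠ 0 := by linarith [hz.2]
  have hne' : 1 - 2 * z ≠ 0 := by linarith [hz.2]
  have hz0 : z ≠ 0 := hz.1.ne'
  have hnum : (z + 1) * Pgf (z ^ 2) - z ^ 2 = Pgf (z ^ 2) * (z + Pgf (z ^ 2)) := by
    linear_combination hquad
  have h : z * (1 - 2 * Pgf (z ^ 2)) * walkGF z (s + 2) 0 =
      Pgf (z ^ 2) * walkGF z (s + 1) 1 := by
    linear_combination (1 - 2 * Pgf (z ^ 2)) * mul_walkGF_succ_zero (s + 1) hz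
      + Pgf (z ^ 2) * mul_walkGF_succ_one (s + 1) hz + Pgf (z ^ 2) * mul_walkGF_two s hz
  refine mul_left_cancel₀ (mul_ne_zero hz0 hne) ?_
  rw [h, walkGF_succ_one s hz, hnum]
  generalize 1 - 2 * Pgf (z ^ 2) = d at hne ⊢
  generalize 1 - 2 * z = e at hne' ⊢
  field_simp
  ring

theorem hasSum_taylor_one_coeff_gP (s : ℕ) {z : ℝ} (hz : z ∈ Set.Ioo (0 : ℝ) (1 / 2)) :
    HasSum (fun p : ℕ × ℕ => (Polynomial.taylor 1 (gP p.1 p.2)).coeff s * z ^ (p.1 + p.2))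
      (walkGF z s 0) := by
  rw [← Finset.HasAntidiagonal.sigmaAntidiagonalEquivProd.hasSum_iff]
  have hfib : ∀ n : ℕ, HasSum (fun p : Finset.HasAntidiagonal.antidiagonal n =>
      (Polynomial.taylor 1 (gP p.1.1 p.1.2)).coeff s * z ^ (p.1.1 + p.1.2))
      (walkCoeff s n 0 * z ^ n) := by
    intro n
    have h : ∑ p : Finset.HasAntidiagonal.antidiagonal n,
        (Polynomial.taylor 1 (gP p.1.1 p.1.2)).coeff s * z ^ (p.1.1 + p.1.2) =
        walkCoeff s n 0 * z ^ n := by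
      rw [Finset.sum_coe_sort (Finset.HasAntidiagonal.antidiagonal n) fun p : ℕ × ℕ =>
        (Polynomial.taylor 1 (gP p.1 p.2)).coeff s * z ^ (p.1 + p.2)]
      rw [walkCoeff, ← sum_antidiagonal_gP, map_sum, Polynomial.finsetSum_coeff, Finset.sum_mul]
      exact Finset.sum_congr rfl fun p hp => by rw [Finset.HasAntidiagonal.mem_antidiagonal.mp hp]
    exact h ▸ hasSum_fintype _
  refine HasSum.sigma_of_hasSum (summable_walkCoeff_mul_pow s 0 hz).hasSum hfib ?_
  refine (summable_sigma_of_nonneg fun p =>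
    mul_nonneg (taylor_one_coeff_gP_nonneg _ _ s) (pow_nonneg hz.1.le _)).mpr
    ⟨fun n => (hfib n).summable, ?_⟩
  exact (summable_walkCoeff_mul_pow s 0 hz).congr fun n => (hfib n).tsum_eq.symm

theorem stmt5 (s : ℕ) (hs : 2 ≤ s) (z : ℝ) (hz : z ∈ Set.Ioo (0 : ℝ) (1 / 2)) :
    Summable (fun p : ℕ × ℕ =>
      (Polynomial.derivative^[s] (gP p.1 p.2)).eval 1 / (s.factorial : ℝ) * z ^ (p.1 + p.2)) ∧
    ∑' p : ℕ × ℕ,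
        (Polynomial.derivative^[s] (gP p.1 p.2)).eval 1 / (s.factorial : ℝ) * z ^ (p.1 + p.2)
      = ((z + 1) * Pgf (z ^ 2) - z ^ 2) * (2 * Pgf (z ^ 2)) ^ (s - 2)
        / (z * (1 - 2 * z) * (1 - 2 * Pgf (z ^ 2)) ^ s) := by
  simp only [eval_one_iterate_derivative_div_factorial]
  have h := hasSum_taylor_one_coeff_gP s hz
  refine ⟨h.summable, h.tsum_eq.trans ?_⟩
  obtain ⟨t, rfl⟩ := Nat.exists_eq_add_of_le' hs
  exact walkGF_add_two_zero t hz
end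

section
/- For every fixed integer s ≥ 0, as n → ∞, (Σ_{m=0}^{n} [w^s] g_{m,n−m}(1+w)) / (2^n · n^{s/2}) converges to 1/(2^{s/2}·Γ(s/2 + 1)), where [w^s] g_{m,n−m}(1+w) denotes the coefficient of w^s in the polynomial g_{m,n−m}(1+w), i.e. the s-th derivative of g_{m,n−m}(q) at q = 1 divided by s!. -/
open Filter
open scoped Asymptotics
open Finset.HasAntidiagonal (antidiagonal)

/-- The coefficient of `x ^ n` in `(1 - x) ^ (-a)`. -/
noncomputable def risingCoeff (a : ℝ) (n : ℕ) : ℝ :=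
  ∏ j ∈ Finset.range n, (a + j) / (j + 1)

theorem risingCoeff_succ (a : ℝ) (n : ℕ) :
    (n + 1) * risingCoeff a (n + 1) = (a + n) * risingCoeff a n := by
  rw [risingCoeff, Finset.prod_range_succ, ← risingCoeff]
  field_simp

theorem risingCoeff_pos {a : ℝ} (ha : 0 < a) (n : ℕ) : 0 < risingCoeff a n :=
  Finset.prod_pos fun _ _ => by positivity

theorem risingCoeff_one (n : ℕ) : risingCoeff 1 n = 1 :=
  Finset.prod_eq_one fun j _ => by rw [add_comm]; exact div_self (by positivity)

/-- The Vandermonde convolution `(1 - x) ^ (-a) * (1 - x) ^ (-b) = (1 - x) ^ (-(a + b))`. -/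
theorem sum_antidiagonal_risingCoeff (a b : ℝ) (n : ℕ) :
    ∑ ij ∈ antidiagonal n, risingCoeff a ij.1 * risingCoeff b ij.2
      = risingCoeff (a + b) n := by
  induction n with
  | zero => simp [risingCoeff]
  | succ n ih =>
    have hn : (n + 1 : ℝ) ≠ 0 := by positivity
    apply mul_left_cancel₀ hn
    rw [risingCoeff_succ, ← ih]
    have split : (n + 1 : ℝ) *
          ∑ ij ∈ antidiagonal (n + 1), risingCoeff a ij.1 * risingCoeff b ij.2
        = ∑ ij ∈ antidiagonal (n + 1), (ij.1 * risingCoeff a ij.1) * risingCoeff b ij.2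
        + ∑ ij ∈ antidiagonal (n + 1),
            risingCoeff a ij.1 * (ij.2 * risingCoeff b ij.2) := by
      rw [Finset.mul_sum, ← Finset.sum_add_distrib]
      refine Finset.sum_congr rfl fun ij h => ?_
      have : (ij.1 : ℝ) + ij.2 = n + 1 := by exact_mod_cast Finset.HasAntidiagonal.mem_antidiagonal.1 h
      rw [← this]; ring
    rw [split, Finset.Nat.sum_antidiagonal_succ, Finset.Nat.sum_antidiagonal_succ']
    push_cast
    simp only [risingCoeff_succ, zero_mul, mul_zero, zero_add]
    rw [Finset.mul_sum, ← Finset.sum_add_distrib]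
    refine Finset.sum_congr rfl fun ij h => ?_
    have : (ij.1 : ℝ) + ij.2 = n := by exact_mod_cast Finset.HasAntidiagonal.mem_antidiagonal.1 h
    rw [← this]; ring

theorem tendsto_risingCoeff_div_rpow {a : ℝ} (ha : 0 < a) :
    Tendsto (fun n : ℕ => risingCoeff a n / (n : ℝ) ^ (a - 1)) atTop
      (nhds (1 / Real.Gamma a)) := by
  have h1 : Tendsto (fun n : ℕ => (n : ℝ) / (n + a)) atTop (nhds 1) :=
    tendsto_natCast_div_add_atTop a
  have h2 := h1.div (Real.GammaSeq_tendsto_Gamma a) (Real.Gamma_pos_of_pos ha).ne'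
  refine h2.congr' ?_
  filter_upwards [eventually_gt_atTop 0] with n hn
  have hn' : (0 : ℝ) < n := by exact_mod_cast hn
  have hP : (0 : ℝ) < ∏ j ∈ Finset.range n, (a + j) := Finset.prod_pos fun _ _ => by positivity
  have hfac : ((n.factorial : ℕ) : ℝ) = ∏ j ∈ Finset.range n, ((j : ℝ) + 1) := by
    rw [← Finset.prod_range_add_one_eq_factorial]; push_cast; rfl
  have hf : (0 : ℝ) < n.factorial := by positivity
  have hr : 0 < (n : ℝ) ^ a := by positivity
  simp only [Pi.div_apply, Real.GammaSeq, risingCoeff]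
  rw [Finset.prod_div_distrib, ← hfac, Finset.prod_range_succ, Real.rpow_sub_one hn'.ne']
  field_simp
  ring

theorem risingCoeff_isLittleO {a b : ℝ} (ha : 0 < a) (hab : a < b) :
    risingCoeff a =o[atTop] risingCoeff b := by
  have hb := ha.trans hab
  rw [Asymptotics.isLittleO_iff_tendsto fun n h => absurd h (risingCoeff_pos hb n).ne']
  have h0 : Tendsto (fun n : ℕ => (n : ℝ) ^ (-(b - a))) atTop (nhds 0) :=
    (tendsto_rpow_neg_atTop (sub_pos.2 hab)).comp tendsto_natCast_atTop_atTop
  have h := (((tendsto_risingCoeff_div_rpow ha).div (tendsto_risingCoeff_div_rpow hb)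
    (one_div_pos.2 (Real.Gamma_pos_of_pos hb)).ne')).mul h0
  rw [mul_zero] at h
  refine h.congr' ?_
  filter_upwards [eventually_gt_atTop 0] with n hn
  have hn' : (0 : ℝ) < n := by exact_mod_cast hn
  have e : (n : ℝ) ^ (-(b - a)) = (n : ℝ) ^ (a - 1) / (n : ℝ) ^ (b - 1) := by
    rw [← Real.rpow_sub hn']; congr 1; ring
  have := risingCoeff_pos hb n
  have h1 : 0 < (n : ℝ) ^ (a - 1) := by positivity
  have h2 : 0 < (n : ℝ) ^ (b - 1) := by positivity
  simp only [Pi.div_apply]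
  rw [e]
  field_simp

theorem risingCoeff_succ_sub_isLittleO {a : ℝ} (ha : 0 < a) :
    (fun n => risingCoeff a (n + 1) - risingCoeff a n) =o[atTop]
      fun n => risingCoeff a (n + 1) := by
  rw [Asymptotics.isLittleO_iff_tendsto fun n h => absurd h (risingCoeff_pos ha _).ne']
  have h1 : Tendsto (fun n : ℕ => ((n : ℝ) + 1) / (n + a)) atTop (nhds 1) := by
    simpa [add_comm] using
      tendsto_add_mul_div_add_mul_atTop_nhds (𝕜 := ℝ) 1 a 1 one_ne_zero
  have h2 : Tendsto (fun n : ℕ => 1 - ((n : ℝ) + 1) / (n + a)) atTop (nhds 0) := by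
    simpa using h1.const_sub 1
  refine h2.congr fun n => ?_
  have h := risingCoeff_succ a n
  have hp := risingCoeff_pos ha (n + 1)
  have : 0 < (n : ℝ) + a := by positivity
  field_simp
  linarith

theorem exists_abs_le_of_isBigO {b : ℝ} (hb : 0 < b) {v : ℕ → ℝ}
    (hv : v =O[atTop] risingCoeff b) :
    ∃ C > 0, ∀ n, |v n| ≤ C * risingCoeff b n := by
  obtain ⟨C, hC, h⟩ := Asymptotics.bound_of_isBigO_nat_atTop hv
  refine ⟨C, hC, fun n => ?_⟩
  have := h (risingCoeff_pos hb n).ne'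
  rwa [Real.norm_eq_abs, Real.norm_eq_abs, abs_of_pos (risingCoeff_pos hb n)] at this

theorem exists_abs_le_of_isLittleO {a a' : ℝ} (ha : 0 < a) (ha' : 0 < a') {u : ℕ → ℝ}
    (hu : u =o[atTop] risingCoeff a) {ε : ℝ} (hε : 0 < ε) :
    ∃ C, ∀ n, |u n| ≤ ε * risingCoeff a n + C * risingCoeff a' n := by
  obtain ⟨N, hN⟩ := eventually_atTop.1 (hu.def hε)
  refine ⟨∑ i ∈ Finset.range N, |u i| / risingCoeff a' i, fun n => ?_⟩
  have h1 := risingCoeff_pos ha n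
  have h2 := risingCoeff_pos ha' n
  have hs : ∀ i ∈ Finset.range N, 0 ≤ |u i| / risingCoeff a' i := fun i _ =>
    div_nonneg (abs_nonneg _) (risingCoeff_pos ha' i).le
  rcases le_or_gt N n with h | h
  · have := hN n h
    rw [Real.norm_eq_abs, Real.norm_eq_abs, abs_of_pos h1] at this
    have := mul_nonneg (Finset.sum_nonneg hs) h2.le
    linarith
  · have := Finset.single_le_sum hs (Finset.mem_range.2 h)
    rw [div_le_iff₀ h2] at this
    have := mul_pos hε h1
    linarith

theorem convolution_isLittleO {a b : ℝ} (ha : 0 < a) (hb : 0 < b) {u v : ℕ → ℝ}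
    (hu : u =o[atTop] risingCoeff a) (hv : v =O[atTop] risingCoeff b) :
    (fun n => ∑ ij ∈ antidiagonal n, |u ij.1| * |v ij.2|) =o[atTop]
      risingCoeff (a + b) := by
  obtain ⟨D, hD, hvD⟩ := exists_abs_le_of_isBigO hb hv
  rw [Asymptotics.isLittleO_iff]
  intro ε hε
  obtain ⟨C, hC⟩ := exists_abs_le_of_isLittleO ha (half_pos ha) hu
    (ε := ε / 2 / D) (by positivity)
  have h := ((risingCoeff_isLittleO (a := a / 2 + b) (b := a + b) (by positivity)
    (by linarith)).const_mul_left (C * D)).def (half_pos hε)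
  filter_upwards [h] with n hn
  have hp := risingCoeff_pos (add_pos ha hb) n
  rw [Real.norm_eq_abs, Real.norm_eq_abs, abs_of_pos hp] at hn ⊢
  rw [abs_of_nonneg (Finset.sum_nonneg fun _ _ => by positivity)]
  calc ∑ ij ∈ antidiagonal n, |u ij.1| * |v ij.2|
      ≤ ∑ ij ∈ antidiagonal n, (ε / 2 * (risingCoeff a ij.1 * risingCoeff b ij.2)
          + C * D * (risingCoeff (a / 2) ij.1 * risingCoeff b ij.2)) := by
        refine Finset.sum_le_sum fun ij _ => ?_
        refine (mul_le_mul (hC ij.1) (hvD ij.2) (abs_nonneg _)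
          ((abs_nonneg _).trans (hC ij.1))).trans_eq ?_
        field_simp
    _ = ε / 2 * risingCoeff (a + b) n + C * D * risingCoeff (a / 2 + b) n := by
        rw [Finset.sum_add_distrib, ← Finset.mul_sum, ← Finset.mul_sum,
          sum_antidiagonal_risingCoeff, sum_antidiagonal_risingCoeff]
    _ ≤ ε * risingCoeff (a + b) n := by linarith [le_abs_self (C * D * risingCoeff (a / 2 + b) n)]

/-- A kernel that is asymptotically a convolution by `B * risingCoeff b` sends sequences
asymptotic to `A * risingCoeff a` to sequences asymptotic to `A * B * risingCoeff (a + b)`. -/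
theorem sum_kernel_sub_isLittleO {a b A B : ℝ} (ha : 0 < a) (hb : 0 < b) {u δ : ℕ → ℝ}
    {κ : ℕ → ℕ → ℝ}
    (hu : (fun n => u n - A * risingCoeff a n) =o[atTop] risingCoeff a)
    (hδ : δ =o[atTop] risingCoeff b)
    (hκ : ∀ i j, |κ i j - B * risingCoeff b j| ≤ δ j) :
    (fun n => ∑ ij ∈ antidiagonal n, u ij.1 * κ ij.1 ij.2
      - A * B * risingCoeff (a + b) n) =o[atTop] risingCoeff (a + b) := by
  have hO : u =O[atTop] risingCoeff a := by
    have := hu.isBigO.add ((Asymptotics.isBigO_refl (risingCoeff a) atTop).const_mul_left A)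
    simpa using this
  have h1 := convolution_isLittleO ha hb hu
    ((Asymptotics.isBigO_refl (risingCoeff b) atTop).const_mul_left B)
  have h2 := convolution_isLittleO hb ha hδ hO
  rw [add_comm b a] at h2
  refine Asymptotics.IsBigO.trans_isLittleO (Asymptotics.IsBigO.of_bound 1
    (Eventually.of_forall fun n => ?_)) (h1.add h2)
  rw [one_mul, Real.norm_eq_abs, Real.norm_eq_abs]
  refine le_trans ?_ (le_abs_self _)
  rw [← sum_antidiagonal_risingCoeff, Finset.mul_sum, ← Finset.sum_sub_distrib,
    ← Finset.Nat.sum_antidiagonal_swap (f := fun ij => |δ ij.1| * |u ij.2|),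
    ← Finset.sum_add_distrib]
  refine (Finset.abs_sum_le_sum_abs _ _).trans (Finset.sum_le_sum fun ij _ => ?_)
  have e : u ij.1 * κ ij.1 ij.2 - A * B * (risingCoeff a ij.1 * risingCoeff b ij.2)
      = (u ij.1 - A * risingCoeff a ij.1) * (B * risingCoeff b ij.2)
        + (κ ij.1 ij.2 - B * risingCoeff b ij.2) * u ij.1 := by ring
  rw [e]
  refine (abs_add_le _ _).trans ?_
  exact add_le_add (abs_mul _ _).le ((abs_mul _ _).trans_le
    (mul_le_mul_of_nonneg_right ((hκ _ _).trans (le_abs_self _)) (abs_nonneg _)))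

theorem isLittleO_of_succ {a L : ℝ} (ha : 0 < a) {u : ℕ → ℝ}
    (hu : (fun n => u (n + 1) - L * risingCoeff a n) =o[atTop] risingCoeff a) :
    (fun n => u n - L * risingCoeff a n) =o[atTop] risingCoeff a := by
  have h := risingCoeff_succ_sub_isLittleO ha
  have hO : risingCoeff a =O[atTop] fun n => risingCoeff a (n + 1) := by
    simpa using (Asymptotics.isBigO_refl (fun n => risingCoeff a (n + 1)) atTop).sub h.isBigO
  have h3 := (hu.trans_isBigO hO).sub (h.const_mul_left L)
  have h4 : (fun n => u (n + 1) - L * risingCoeff a (n + 1)) =o[atTop]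
      fun n => risingCoeff a (n + 1) := by
    refine h3.congr_left fun n => ?_
    ring
  rw [Asymptotics.isLittleO_iff] at h4 ⊢
  intro c hc
  rw [← map_add_atTop_eq_nat 1, eventually_map]
  exact h4 hc

theorem tendsto_div_rpow_of_isLittleO {a L : ℝ} (ha : 0 < a) {u : ℕ → ℝ}
    (hu : (fun n => u n - L * risingCoeff a n) =o[atTop] risingCoeff a) :
    Tendsto (fun n : ℕ => u n / (n : ℝ) ^ (a - 1)) atTop (nhds (L / Real.Gamma a)) := by
  have h1 := (hu.tendsto_div_nhds_zero.add_const L).mul (tendsto_risingCoeff_div_rpow ha)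
  rw [zero_add, mul_one_div] at h1
  refine h1.congr fun n => ?_
  have := risingCoeff_pos ha n
  field_simp
  ring

open Polynomial in
/-- The coefficient of `X ^ m` counts the lattice paths of length `n` with `m` up-steps and `s`
marked steps, where an up-step at time `i` can be marked if it is preceded by exactly
`(i + 1) / 2` up-steps. -/
noncomputable def markedPaths : ℕ → ℕ → ℝ[X]
  | 0, n => (1 + X) ^ n
  | s + 1, n => ∑ i ∈ Finset.range n,
      C ((markedPaths s i).coeff ((i + 1) / 2)) * (X ^ ((i + 1) / 2 + 1) * (1 + X) ^ (n - 1 - i))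

/-- The number of lattice paths of length `n` with `s` marked steps whose next up-step can be
marked, normalized by `2 ^ n`. -/
noncomputable def markedReturn (s n : ℕ) : ℝ :=
  (markedPaths s n).coeff ((n + 1) / 2) / 2 ^ n

section Combinatorics

open Polynomial

theorem markedPaths_zero_succ (n : ℕ) :
    markedPaths 0 (n + 1) = (1 + X) * markedPaths 0 n := by
  simp only [markedPaths]; ring

theorem markedPaths_succ_succ (s n : ℕ) :
    markedPaths (s + 1) (n + 1) = (1 + X) * markedPaths (s + 1) n
      + C ((markedPaths s n).coeff ((n + 1) / 2)) * X ^ ((n + 1) / 2 + 1) := by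
  rw [markedPaths, Finset.sum_range_succ, markedPaths, Finset.mul_sum]
  congr 1
  · refine Finset.sum_congr rfl fun i hi => ?_
    have := Finset.mem_range.1 hi
    rw [show n + 1 - 1 - i = n - 1 - i + 1 by omega, pow_succ (1 + X : ℝ[X])]
    ring
  · simp

theorem coeff_markedPaths_of_lt (s n m : ℕ) (h : n < m) : (markedPaths s n).coeff m = 0 := by
  cases s with
  | zero => simp [markedPaths, coeff_one_add_X_pow, Nat.choose_eq_zero_of_lt h]
  | succ s =>
    rw [markedPaths, finsetSum_coeff]
    refine Finset.sum_eq_zero fun i hi => ?_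
    have := Finset.mem_range.1 hi
    rw [coeff_C_mul, coeff_X_pow_mul', coeff_one_add_X_pow]
    split_ifs
    · rw [Nat.choose_eq_zero_of_lt (by omega)]; simp
    · simp

theorem coeff_markedPaths_succ_zero (s n : ℕ) :
    (markedPaths s (n + 1)).coeff 0 = (markedPaths s n).coeff 0 := by
  cases s with
  | zero => rw [markedPaths_zero_succ]; simp [add_mul]
  | succ s => rw [markedPaths_succ_succ]; simp [add_mul, pow_succ]

theorem coeff_taylor_X_pow_mul_add (s n m : ℕ) {p q : ℝ[X]}
    (hp : ∀ s, (taylor 1 p).coeff s = (markedPaths s n).coeff m)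
    (hq : ∀ s, (taylor 1 q).coeff s = (markedPaths s n).coeff (m + 1)) :
    (taylor 1 (X ^ (if (n + 1) / 2 + 1 = m + 1 then 1 else 0) * p + q)).coeff s
      = (markedPaths s (n + 1)).coeff (m + 1) := by
  have hX : taylor (1 : ℝ) X = X + 1 := by simp
  rw [map_add, coeff_add, hq, taylor_mul, taylor_pow, hX]
  cases s with
  | zero =>
    rw [markedPaths_zero_succ]
    simp only [mul_coeff_zero, hp, add_mul, coeff_add, coeff_X_mul, one_mul]
    split_ifs <;> simp [add_comm]
  | succ s =>
    rw [markedPaths_succ_succ, coeff_add, coeff_C_mul, coeff_X_pow, add_mul, coeff_add,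
      coeff_X_mul, one_mul]
    split_ifs with h h' h'
    · rw [pow_one, add_mul, coeff_add, one_mul, coeff_X_mul, hp, hp, Nat.succ_injective h]
      ring
    · exact absurd h.symm h'
    · exact absurd h'.symm h
    · rw [pow_zero, one_mul, hp]; ring

theorem coeff_taylor_gP (s m k : ℕ) :
    (taylor (1 : ℝ) (gP m k)).coeff s = (markedPaths s (m + k)).coeff m := by
  induction m, k using gP.induct generalizing s with
  | case1 =>
    rw [gP, taylor_one]
    cases s <;> simp [markedPaths, coeff_one]
  | case2 k ih =>
    rw [gP, ih, zero_add, zero_add, coeff_markedPaths_succ_zero]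
  | case3 m ih =>
    rw [gP]
    simpa using coeff_taylor_X_pow_mul_add s m m (q := 0) ih
      (by simp [coeff_markedPaths_of_lt])
  | case4 m k ih1 ih2 =>
    have h : m + 1 + k = m + (k + 1) := by ring
    rw [gP, ← add_assoc (m + 1), h]
    exact coeff_taylor_X_pow_mul_add s (m + (k + 1)) m ih1 (fun s => h ▸ ih2 s)

theorem sum_coeff_taylor_gP (s n : ℕ) :
    ∑ m ∈ Finset.range (n + 1), (taylor (1 : ℝ) (gP m (n - m))).coeff s
      = (markedPaths s n).eval 1 := by
  rw [eval_eq_sum_range' (n := n + 1)]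
  · refine Finset.sum_congr rfl fun m hm => ?_
    have := Finset.mem_range.1 hm
    rw [coeff_taylor_gP, one_pow, mul_one, show m + (n - m) = n by omega]
  · exact Nat.lt_succ_of_le (natDegree_le_iff_coeff_eq_zero.2 fun m hm =>
      coeff_markedPaths_of_lt s n m hm)

theorem eval_markedPaths_succ (s n : ℕ) :
    (markedPaths (s + 1) (n + 1)).eval 1 / 2 ^ (n + 1)
      = ∑ ij ∈ antidiagonal n, markedReturn s ij.1 * (1 / 2) := by
  rw [Finset.Nat.sum_antidiagonal_eq_sum_range_succ_mk, markedPaths, eval_finsetSum,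
    Finset.sum_div]
  refine Finset.sum_congr rfl fun i hi => ?_
  have := Finset.mem_range.1 hi
  obtain ⟨j, rfl⟩ : ∃ j, n = i + j := ⟨n - i, by omega⟩
  simp only [markedReturn, eval_mul, eval_C, eval_pow, eval_add, eval_X, eval_one, one_pow,
    one_add_one_eq_two, one_mul]
  rw [show i + j + 1 - 1 - i = j by omega, pow_succ, pow_add]
  field_simp

/-- The transition probability of simple random walk from the end of an up-step marked at time
`i` to a position where an up-step can be marked, `j` steps later. -/
noncomputable def returnKernel (i j : ℕ) : ℝ :=
  ((X ^ ((i + 1) / 2 + 1) * (1 + X) ^ j : ℝ[X]).coeff ((i + j + 1 + 1) / 2)) / 2 ^ j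

theorem markedReturn_succ (s n : ℕ) :
    markedReturn (s + 1) (n + 1)
      = ∑ ij ∈ antidiagonal n, markedReturn s ij.1 * (1 / 2 * returnKernel ij.1 ij.2) := by
  rw [Finset.Nat.sum_antidiagonal_eq_sum_range_succ_mk, markedReturn, markedPaths,
    finsetSum_coeff, Finset.sum_div]
  refine Finset.sum_congr rfl fun i hi => ?_
  have := Finset.mem_range.1 hi
  obtain ⟨j, rfl⟩ : ∃ j, n = i + j := ⟨n - i, by omega⟩
  simp only [markedReturn, returnKernel, coeff_C_mul]
  rw [show i + j + 1 - 1 - i = j by omega, show i + j - i = j by omega, pow_succ (2 : ℝ),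
    pow_add (2 : ℝ)]
  field_simp

theorem abs_returnKernel_sub_le (i j : ℕ) :
    |returnKernel i j - (j.choose (j / 2) : ℝ) / 2 ^ j|
      ≤ 2 / (j + 2) * ((j.choose (j / 2) : ℝ) / 2 ^ j) := by
  rw [returnKernel, coeff_X_pow_mul', coeff_one_add_X_pow, ← sub_div, abs_div,
    abs_of_pos (show (0 : ℝ) < 2 ^ j by positivity), ← mul_div_assoc]
  gcongr
  by_cases hj : j = 0
  · subst hj
    split_ifs with h
    · rw [show (i + 0 + 1 + 1) / 2 - ((i + 1) / 2 + 1) = 0 by omega]; simp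
    · simp
  rw [if_pos (by omega)]
  have hcases : (i + j + 1 + 1) / 2 - ((i + 1) / 2 + 1) = j / 2 ∨
      ∃ l, j = 2 * l + 2 ∧ (i + j + 1 + 1) / 2 - ((i + 1) / 2 + 1) = l := by
    rcases Nat.even_or_odd' j with ⟨l, rfl | rfl⟩
    · rcases Nat.even_or_odd' i with ⟨k, rfl | rfl⟩
      · left; omega
      · right; exact ⟨l - 1, by omega, by omega⟩
    · left; omega
  rcases hcases with h | ⟨l, rfl, h⟩
  · rw [h, sub_self, abs_zero]; positivity
  · rw [h, show (2 * l + 2) / 2 = l + 1 by omega]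
    have hc := Nat.choose_succ_right_eq (2 * l + 2) l
    rw [show 2 * l + 2 - l = l + 2 by omega] at hc
    have hc' : ((2 * l + 2).choose (l + 1) : ℝ) * (l + 1) = (2 * l + 2).choose l * (l + 2) := by
      exact_mod_cast hc
    have e : ((2 * l + 2).choose l : ℝ) - (2 * l + 2).choose (l + 1)
        = -(1 / (l + 2) * (2 * l + 2).choose (l + 1)) := by
      field_simp
      linarith
    rw [e, abs_neg, abs_of_nonneg (by positivity)]
    refine mul_le_mul_of_nonneg_right ?_ (by positivity)
    push_cast
    rw [div_le_div_iff₀ (by positivity) (by positivity)]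
    linarith

theorem centralBinom_div_four_pow (n : ℕ) :
    (n.centralBinom : ℝ) / 4 ^ n = risingCoeff (1 / 2) n := by
  induction n with
  | zero => simp [risingCoeff]
  | succ n ih =>
    have hn : (n + 1 : ℝ) ≠ 0 := by positivity
    have h : ((n : ℝ) + 1) * (n + 1).centralBinom = 2 * (2 * n + 1) * n.centralBinom := by
      exact_mod_cast Nat.succ_mul_centralBinom_succ n
    apply mul_left_cancel₀ hn
    rw [risingCoeff_succ, ← ih, ← mul_div_assoc, h, pow_succ]
    field_simp
    ring

theorem choose_half_div_two_pow (k : ℕ) :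
    (k.choose (k / 2) : ℝ) / 2 ^ k = risingCoeff (1 / 2) ((k + 1) / 2) := by
  rw [← centralBinom_div_four_pow]
  rcases Nat.even_or_odd' k with ⟨l, rfl | rfl⟩
  · rw [show (2 * l + 1) / 2 = l by omega, show 2 * l / 2 = l by omega, Nat.centralBinom, pow_mul]
    norm_num
  · rw [show (2 * l + 1) / 2 = l by omega, show (2 * l + 1 + 1) / 2 = l + 1 by omega,
      Nat.centralBinom, show 2 * (l + 1) = 2 * l + 1 + 1 by ring, Nat.choose_succ_succ,
      ← Nat.choose_symm_half, show (4 : ℝ) = 2 ^ 2 by norm_num, ← pow_mul]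
    push_cast
    field_simp
    ring

theorem choose_half_div_two_pow_sub_isLittleO :
    (fun k : ℕ => (k.choose (k / 2) : ℝ) / 2 ^ k - √2 * risingCoeff (1 / 2) k) =o[atTop]
      risingCoeff (1 / 2) := by
  have hh : (0 : ℝ) < 1 / 2 := by norm_num
  have hG := one_div_pos.2 (Real.Gamma_pos_of_pos hh)
  have hidx : Tendsto (fun k : ℕ => (k + 1) / 2) atTop atTop :=
    tendsto_atTop.2 fun b => (eventually_ge_atTop (2 * b)).mono fun k hk => by omega
  have hr := tendsto_risingCoeff_div_rpow hh
  have hq := (hr.comp hidx).div hr hG.ne'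
  rw [div_self hG.ne'] at hq
  have hpar : Tendsto (fun k : ℕ => (((k + 1) / 2 : ℕ) : ℝ) / k) atTop (nhds (1 / 2)) := by
    have hinv := tendsto_one_div_atTop_nhds_zero_nat (𝕜 := ℝ)
    have hup : Tendsto (fun k : ℕ => (1 : ℝ) / 2 + 1 / k) atTop (nhds (1 / 2)) := by
      simpa using hinv.const_add ((1 : ℝ) / 2)
    refine tendsto_of_tendsto_of_tendsto_of_le_of_le' tendsto_const_nhds hup ?_ ?_
    · filter_upwards [eventually_gt_atTop 0] with k hk
      have hk' : (0 : ℝ) < k := by exact_mod_cast hk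
      have : (k : ℝ) ≤ 2 * ((k + 1) / 2 : ℕ) := by exact_mod_cast (by omega)
      rw [div_le_div_iff₀ two_pos hk']
      linarith
    · filter_upwards [eventually_gt_atTop 0] with k hk
      have hk' : (0 : ℝ) < k := by exact_mod_cast hk
      have : 2 * (((k + 1) / 2 : ℕ) : ℝ) ≤ k + 1 := by exact_mod_cast (by omega)
      field_simp
      linarith
  have hpow := hpar.rpow_const (p := 1 / 2 - 1) (Or.inl (by norm_num))
  have hsq : ((1 : ℝ) / 2) ^ ((1 : ℝ) / 2 - 1) = √2 := by
    rw [show (1 : ℝ) / 2 - 1 = -(1 / 2) by norm_num, one_div 2, Real.inv_rpow two_pos.le,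
      Real.rpow_neg two_pos.le, inv_inv, Real.sqrt_eq_rpow, one_div]
  rw [hsq] at hpow
  rw [Asymptotics.isLittleO_iff_tendsto fun n h => absurd h (risingCoeff_pos hh _).ne']
  have h := (hq.mul hpow).sub_const √2
  rw [one_mul, sub_self] at h
  refine h.congr' ?_
  filter_upwards [eventually_gt_atTop 0] with k hk
  have hk' : (0 : ℝ) < k := by exact_mod_cast hk
  have hk2 : (0 : ℝ) < ((k + 1) / 2 : ℕ) := by exact_mod_cast (by omega)
  have := risingCoeff_pos hh k
  simp only [Pi.div_apply, Function.comp_apply, choose_half_div_two_pow]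
  rw [Real.div_rpow hk2.le hk'.le]
  have h1 : 0 < (k : ℝ) ^ ((1 : ℝ) / 2 - 1) := by positivity
  have h2 : 0 < (((k + 1) / 2 : ℕ) : ℝ) ^ ((1 : ℝ) / 2 - 1) := by positivity
  generalize (k : ℝ) ^ ((1 : ℝ) / 2 - 1) = x at *
  generalize (((k + 1) / 2 : ℕ) : ℝ) ^ ((1 : ℝ) / 2 - 1) = y at *
  field_simp

theorem markedReturn_zero (n : ℕ) :
    markedReturn 0 n = (n.choose (n / 2) : ℝ) / 2 ^ n := by
  rw [markedReturn, markedPaths, coeff_one_add_X_pow,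
    ← Nat.choose_symm_of_eq_add (show n = n / 2 + (n + 1) / 2 by omega)]

theorem exists_returnKernel_bound :
    ∃ δ : ℕ → ℝ, δ =o[atTop] risingCoeff (1 / 2) ∧
      ∀ i j, |1 / 2 * returnKernel i j - √2 / 2 * risingCoeff (1 / 2) j| ≤ δ j := by
  set β : ℕ → ℝ := fun j => (j.choose (j / 2) : ℝ) / 2 ^ j with hβ
  have hβo := choose_half_div_two_pow_sub_isLittleO
  have hβO : β =O[atTop] risingCoeff (1 / 2) := by
    have := hβo.isBigO.add
      ((Asymptotics.isBigO_refl (risingCoeff (1 / 2)) atTop).const_mul_left √2)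
    simpa [hβ] using this
  refine ⟨fun j => 2 / (j + 2) * β j + |β j - √2 * risingCoeff (1 / 2) j|,
    Asymptotics.IsLittleO.add ?_ hβo.abs_left, fun i j => ?_⟩
  · have h0 : (fun j : ℕ => (2 : ℝ) / (j + 2)) =o[atTop] fun _ => (1 : ℝ) := by
      rw [Asymptotics.isLittleO_one_iff]
      exact tendsto_const_nhds.div_atTop
        (tendsto_atTop_add_const_right _ _ tendsto_natCast_atTop_atTop)
    simpa using h0.mul_isBigO hβO
  · have h1 := abs_returnKernel_sub_le i j
    rw [show 1 / 2 * returnKernel i j - √2 / 2 * risingCoeff (1 / 2) j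
      = 1 / 2 * ((returnKernel i j - β j) + (β j - √2 * risingCoeff (1 / 2) j)) by ring,
      abs_mul, abs_of_pos (by norm_num : (0 : ℝ) < 1 / 2)]
    have h2 := abs_add_le (returnKernel i j - β j) (β j - √2 * risingCoeff (1 / 2) j)
    have h3 := abs_nonneg ((returnKernel i j - β j) + (β j - √2 * risingCoeff (1 / 2) j))
    linarith

theorem markedReturn_sub_isLittleO (s : ℕ) :
    (fun n => markedReturn s n - √2 * (√2 / 2) ^ s * risingCoeff (((s : ℝ) + 1) / 2) n) =o[atTop]
      risingCoeff (((s : ℝ) + 1) / 2) := by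
  induction s with
  | zero =>
    simpa [markedReturn_zero] using choose_half_div_two_pow_sub_isLittleO
  | succ s ih =>
    obtain ⟨δ, hδ, hκ⟩ := exists_returnKernel_bound
    have h := sum_kernel_sub_isLittleO (by positivity) (by norm_num) ih hδ hκ
    simp only [← markedReturn_succ] at h
    rw [show ((s : ℝ) + 1) / 2 + 1 / 2 = ((s + 1 : ℕ) + 1 : ℝ) / 2 by push_cast; ring,
      mul_assoc √2, ← pow_succ] at h
    exact isLittleO_of_succ (by positivity) h

theorem eval_markedPaths_sub_isLittleO (s : ℕ) :
    (fun n => (markedPaths s n).eval 1 / 2 ^ n - (√2 / 2) ^ s * risingCoeff ((s : ℝ) / 2 + 1) n)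
      =o[atTop] risingCoeff ((s : ℝ) / 2 + 1) := by
  cases s with
  | zero =>
    simp [markedPaths, risingCoeff_one, one_add_one_eq_two]
  | succ s =>
    have h := sum_kernel_sub_isLittleO (b := 1) (B := 1 / 2) (δ := 0)
      (κ := fun _ _ => 1 / 2) (by positivity) one_pos (markedReturn_sub_isLittleO s)
      (Asymptotics.isLittleO_zero _ _) (by simp [risingCoeff_one])
    simp only [← eval_markedPaths_succ] at h
    rw [show ((s : ℝ) + 1) / 2 + 1 = ((s + 1 : ℕ) : ℝ) / 2 + 1 by push_cast; ring,
      show √2 * (√2 / 2) ^ s * (1 / 2) = (√2 / 2) ^ (s + 1) by ring] at h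
    exact isLittleO_of_succ (by positivity) h

end Combinatorics

theorem stmt6 (s : ℕ) :
    Tendsto (fun n : ℕ =>
        (∑ m ∈ Finset.range (n + 1), (Polynomial.taylor (1 : ℝ) (gP m (n - m))).coeff s)
          / (2 ^ n * (n : ℝ) ^ ((s : ℝ) / 2)))
      atTop (nhds (1 / (2 ^ ((s : ℝ) / 2) * Real.Gamma ((s : ℝ) / 2 + 1)))) := by
  have h := tendsto_div_rpow_of_isLittleO (by positivity) (eval_markedPaths_sub_isLittleO s)
  have hc : (√2 / 2) ^ s = 1 / (2 : ℝ) ^ ((s : ℝ) / 2) := by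
    rw [Real.sqrt_div_self', Real.sqrt_eq_rpow, div_pow, one_pow,
      ← Real.rpow_mul_natCast two_pos.le]
    congr 2
    ring
  simpa only [sum_coeff_taylor_gP, hc, div_div, add_sub_cancel_right] using h
end
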